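/- arXiv:1311.1765 — 2 statements merged into one kernel-verified Lean document; each statement's English description precedes it below -/
import Mathlib

section
/- Let k≥3 be an integer, let G be a digraph not satisfying condition C_∞, and let D be a non-self-dual arc-connected component of G which is an interval of G. Then: (1) G[D] and (G[D])* are (≤k)-hypomorphic if and only if C_dual(G[D]) ≥ k+1; (2) if C_dual(G[D])=5, then G[D] is a proper prechain; (3) if C_dual(G[D])=6, then G[D] is a diamond-free tournament; (4) if C_dual(G[D])≥7, then G[D] is a one-end infinite consecutivity. -/
universe u v

/-- A digraph: an irreflexive binary relation on a vertex type. -/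
structure Dgraph (V : Type u) where
  Arc : V → V → Prop
  irrefl : ∀ x, ¬ Arc x x

namespace Dgraph

variable {V : Type u} {W : Type v}

/-- The dual digraph. -/
def dual (G : Dgraph V) : Dgraph V :=
  ⟨fun x y => G.Arc y x, fun x h => G.irrefl x h⟩

/-- Subdigraph induced by a set of vertices. -/
def ind (G : Dgraph V) (X : Set V) : Dgraph X :=
  ⟨fun x y => G.Arc x y, fun x h => G.irrefl x h⟩

/-- Isomorphism of digraphs. -/
def Iso (G : Dgraph V) (G' : Dgraph W) : Prop :=
  ∃ e : V ≃ W, ∀ x y, G.Arc x y ↔ G'.Arc (e x) (e y)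

/-- `G` and `G'` are hemimorphic: `G'` is isomorphic to `G` or to its dual. -/
def Hemi (G : Dgraph V) (G' : Dgraph W) : Prop :=
  Iso G G' ∨ Iso G.dual G'

/-- Self-dual digraph. -/
def SelfDual (G : Dgraph V) : Prop := Iso G G.dual

/-- `{x,y}` is a directed pair. -/
def Dir (G : Dgraph V) (x y : V) : Prop :=
  (G.Arc x y ∧ ¬ G.Arc y x) ∨ (G.Arc y x ∧ ¬ G.Arc x y)

/-- `{x,y}` is a neutral pair (full or void). -/
def Neutral (G : Dgraph V) (x y : V) : Prop :=
  x ≠ y ∧ ¬ G.Dir x y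

/-- Interval of a digraph. -/
def IsInterval (G : Dgraph V) (I : Set V) : Prop :=
  ∀ x ∉ I,
    (∀ y ∈ I, G.Arc x y ∧ ¬ G.Arc y x) ∨ (∀ y ∈ I, G.Arc y x ∧ ¬ G.Arc x y) ∨
    (∀ y ∈ I, G.Arc x y ∧ G.Arc y x) ∨ (∀ y ∈ I, ¬ G.Arc x y ∧ ¬ G.Arc y x)

/-- The arc-connectivity equivalence relation. -/
def ACRel (G : Dgraph V) : V → V → Prop := Relation.ReflTransGen G.Dir

/-- Arc-connected components. -/
def IsACComponent (G : Dgraph V) (D : Set V) : Prop :=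
  ∃ x, D = {y | G.ACRel x y}

/-- Arc-connected digraph (at most one arc-connected component). -/
def ArcConnected (G : Dgraph V) : Prop := ∀ x y, G.ACRel x y

/-- Tournament. -/
def IsTournament (G : Dgraph V) : Prop := ∀ x y, x ≠ y → G.Dir x y

/-- Chain (transitive tournament). -/
def IsChainD (G : Dgraph V) : Prop :=
  G.IsTournament ∧ ∀ x y z, G.Arc x y → G.Arc y z → G.Arc x z

/-- Dgraph from a relation, with forced irreflexivity. -/
def ofRel (r : V → V → Prop) : Dgraph V := ⟨fun x y => x ≠ y ∧ r x y, fun x h => h.1 rfl⟩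

/-- The model flag. -/
def flagD : Dgraph (Fin 3) :=
  ofRel (fun x y => (x = 0 ∧ y = 1) ∨ (x = 1 ∧ y = 2) ∨ (x = 2 ∧ y = 1))

/-- First model peak. -/
def peakD1 : Dgraph (Fin 3) :=
  ofRel (fun x y => (x = 0 ∧ y = 1) ∨ (x = 0 ∧ y = 2) ∨ (x = 1 ∧ y = 2) ∨ (x = 2 ∧ y = 1))

/-- Second model peak. -/
def peakD2 : Dgraph (Fin 3) :=
  ofRel (fun x y => (x = 0 ∧ y = 1) ∨ (x = 0 ∧ y = 2))

/-- The model diamond. -/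
def diamondD : Dgraph (Fin 4) :=
  ofRel (fun x y => (x = 0 ∧ y = 1) ∨ (x = 0 ∧ y = 2) ∨ (x = 0 ∧ y = 3) ∨
    (x = 1 ∧ y = 2) ∨ (x = 2 ∧ y = 3) ∨ (x = 3 ∧ y = 1))

/-- A flag is a digraph hemimorphic to the model flag. -/
def IsFlag (G : Dgraph V) : Prop := Hemi G flagD

/-- A peak is a digraph hemimorphic to one of the two model peaks. -/
def IsPeak (G : Dgraph V) : Prop := Hemi G peakD1 ∨ Hemi G peakD2

/-- A diamond is a digraph hemimorphic to the model diamond. -/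
def IsDiamond (G : Dgraph V) : Prop := Hemi G diamondD

/-- Prechain: embeds no peak, no diamond, no two adjacent neutral pairs. -/
def IsPrechain (G : Dgraph V) : Prop :=
  (∀ X : Set V, ¬ IsPeak (G.ind X)) ∧ (∀ X : Set V, ¬ IsDiamond (G.ind X)) ∧
  ¬ ∃ x y z : V, y ≠ z ∧ G.Neutral x y ∧ G.Neutral x z

/-- Proper prechain: a prechain which is not a chain. -/
def ProperPrechain (G : Dgraph V) : Prop := G.IsPrechain ∧ ¬ G.IsChainD

/-- Diamond-free tournament. -/
def DiamondFreeTournament (G : Dgraph V) : Prop :=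
  G.IsTournament ∧ ∀ X : Set V, ¬ IsDiamond (G.ind X)

/-- Non-tournament prechain. -/
def NonTournamentPrechain (G : Dgraph V) : Prop := G.IsPrechain ∧ ¬ G.IsTournament

/-- Model finite consecutivity on `n` vertices (`full` decides whether the
non-consecutive pairs are all full or all void). -/
def consecFin (n : ℕ) (full : Bool) : Dgraph (Fin n) :=
  ofRel (fun i j => i.1 + 1 = j.1 ∨ (full = true ∧ (i.1 + 1 < j.1 ∨ j.1 + 1 < i.1)))

/-- Model consecutivity of type ω. -/
def consecNat (full : Bool) : Dgraph ℕ :=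
  ofRel (fun i j => i + 1 = j ∨ (full = true ∧ (i + 1 < j ∨ j + 1 < i)))

/-- Model consecutivity of type ω*+ω. -/
def consecInt (full : Bool) : Dgraph ℤ :=
  ofRel (fun i j => i + 1 = j ∨ (full = true ∧ (i + 1 < j ∨ j + 1 < i)))

/-- One-end infinite consecutivity (obtained from ω or ω*). -/
def OneEndInfiniteConsecutivity (G : Dgraph V) : Prop :=
  ∃ full, Iso G (consecNat full) ∨ Iso G (consecNat full).dual

/-- Consecutivity. -/
def IsConsecutivity (G : Dgraph V) : Prop :=
  (∃ n, 3 ≤ n ∧ ∃ full, Iso G (consecFin n full)) ∨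
  G.OneEndInfiniteConsecutivity ∨ (∃ full, Iso G (consecInt full))

/-- Model cycle on `n ≥ 3` vertices obtained from the finite consecutivity by
replacing the neutral pair `{0, n-1}` by the arc `(n-1, 0)`. -/
def cycleD (n : ℕ) (full : Bool) : Dgraph (Fin n) :=
  ofRel (fun i j => i.1 + 1 = j.1 ∨ (i.1 = n - 1 ∧ j.1 = 0) ∨
    (full = true ∧ (i.1 + 1 < j.1 ∨ j.1 + 1 < i.1) ∧
      ¬ (i.1 = 0 ∧ j.1 = n - 1) ∧ ¬ (i.1 = n - 1 ∧ j.1 = 0)))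

/-- Cycle. -/
def IsCycle (G : Dgraph V) : Prop := ∃ n, 3 ≤ n ∧ ∃ full, Iso G (cycleD n full)

/-- Near-chain: obtained from a chain by exchanging the directed pair formed
by its extremities. -/
def IsNearChain (G : Dgraph V) : Prop :=
  ∃ (H : Dgraph V) (m M : V), H.IsChainD ∧ m ≠ M ∧
    (∀ x, x ≠ m → H.Arc m x) ∧ (∀ x, x ≠ M → H.Arc x M) ∧
    (∀ x y, G.Arc x y ↔ ((H.Arc x y ∧ ¬ (x = m ∧ y = M)) ∨ (x = M ∧ y = m)))

/-- `{k}`-hypomorphy. -/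
def KHypo (k : ℕ) (G G' : Dgraph V) : Prop :=
  ∀ X : Set V, X.Finite → X.ncard = k → Iso (G.ind X) (G'.ind X)

/-- `(≤ k)`-hypomorphy. -/
def LeHypo (k : ℕ) (G G' : Dgraph V) : Prop :=
  ∀ j, 1 ≤ j → j ≤ k → KHypo j G G'

/-- `{k}`-hemimorphy. -/
def KHemi (k : ℕ) (G G' : Dgraph V) : Prop :=
  ∀ X : Set V, X.Finite → X.ncard = k → Hemi (G.ind X) (G'.ind X)

/-- `(≤ k)`-hemimorphy. -/
def LeHemi (k : ℕ) (G G' : Dgraph V) : Prop :=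
  ∀ j, 1 ≤ j → j ≤ k → KHemi j G G'

/-- `(≤ k)`-half-reconstructibility. -/
def HalfRecon (k : ℕ) (G : Dgraph V) : Prop :=
  ∀ G' : Dgraph V, LeHemi k G G' → Hemi G G'

/-- One step of the difference relation. -/
def DiffStep (G G' : Dgraph V) (x y : V) : Prop := G.Arc x y ↔ ¬ G'.Arc x y

/-- The difference relation `𝔇_{G,G'}`. -/
def DiffRel (G G' : Dgraph V) (x y : V) : Prop :=
  x = y ∨ Relation.TransGen (DiffStep G G') x y

/-- Difference classes: `C ∈ D_{G,G'}`. -/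
def DiffClass (G G' : Dgraph V) (C : Set V) : Prop :=
  ∃ x, C = {y | DiffRel G G' x y}

/-- The difference relation has at least two equivalence classes. -/
def AtLeastTwoDiffClasses (G G' : Dgraph V) : Prop :=
  ∃ C₁ C₂ : Set V, DiffClass G G' C₁ ∧ DiffClass G G' C₂ ∧ C₁ ≠ C₂

/-- `C_dual(G)`: the smallest cardinality of a finite set of vertices inducing a
non-self-dual subdigraph (`⊤` if there is none). -/
noncomputable def Cdual (G : Dgraph V) : ℕ∞ :=
  sInf {n : ℕ∞ | ∃ X : Set V, X.Finite ∧ ¬ SelfDual (G.ind X) ∧ n = (X.ncard : ℕ∞)}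

/-- The contracted digraph `G_I` (the vertex `none` plays the role of `I`). -/
def contract (G : Dgraph V) (I : Set V) : Dgraph (Option {x : V // x ∉ I}) where
  Arc := fun a b =>
    match a, b with
    | some x, some y => G.Arc x.1 y.1
    | some x, none => ∃ z ∈ I, G.Arc x.1 z
    | none, some y => ∃ z ∈ I, G.Arc z y.1
    | none, none => False
  irrefl := by
    rintro (_ | ⟨x, hx⟩)
    · simp
    · exact G.irrefl x

/-- There is an isomorphism `f` from `G_I` onto `G'_I` with `f(I) = I`. -/
def ContractIsoFix (G G' : Dgraph V) (I : Set V) : Prop :=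
  ∃ e : Option {x : V // x ∉ I} ≃ Option {x : V // x ∉ I},
    e none = none ∧ ∀ a b, (G.contract I).Arc a b ↔ (G'.contract I).Arc (e a) (e b)

/-- `D` is disjoint from every flag of `G`. -/
def FlagDisjoint (G : Dgraph V) (D : Set V) : Prop :=
  ∀ F : Set V, IsFlag (G.ind F) → D ∩ F = ∅

/-- `D` contains a vertex `a` of a flag `{a,b,c}` of `G` with `b, c ∉ D` and
`{b,c}` the directed pair of the flag. -/
def FlagVertexCond (G : Dgraph V) (D : Set V) : Prop :=
  ∃ a ∈ D, ∃ b c : V, b ∉ D ∧ c ∉ D ∧ IsFlag (G.ind {a, b, c}) ∧ G.Dir b c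

/-- Condition `C_∞`. -/
def CondCinf (G : Dgraph V) : Prop :=
  (∃ I : Set V, I.Infinite ∧ G.IsInterval I ∧ (G.ind I).IsChainD) ∨
  (∃ I J : Set V, I ≠ J ∧ G.IsInterval I ∧ G.IsInterval J ∧
     (G.ind I).OneEndInfiniteConsecutivity ∧ (G.ind J).OneEndInfiniteConsecutivity) ∨
  (∃ I : Set V, G.IsInterval I ∧ (G.ind I).OneEndInfiniteConsecutivity ∧
     (∀ J : Set V, G.IsInterval J → (G.ind J).OneEndInfiniteConsecutivity → J = I) ∧
     ¬ ContractIsoFix G G.dual I)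

/-- The kind of component occurring in conditions `K1` and `K2`. -/
def K12Kind (G : Dgraph V) (D : Set V) : Prop :=
  DiamondFreeTournament (G.ind D) ∨ (NonTournamentPrechain (G.ind D) ∧ G.FlagDisjoint D)

/-- Condition `K1`. -/
def CondK1 (G : Dgraph V) : Prop :=
  G.Cdual = 3 ∧ ∃ D₁ D₂ : Set V, D₁ ≠ D₂ ∧
    (G.IsACComponent D₁ ∧ ¬ SelfDual (G.ind D₁) ∧ G.IsInterval D₁ ∧ G.K12Kind D₁) ∧
    (G.IsACComponent D₂ ∧ ¬ SelfDual (G.ind D₂) ∧ G.IsInterval D₂ ∧ G.K12Kind D₂)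

/-- Condition `K2`. -/
def CondK2 (G : Dgraph V) : Prop :=
  G.Cdual = 3 ∧ ∃ D₀ : Set V, G.IsACComponent D₀ ∧ ¬ SelfDual (G.ind D₀) ∧
    (∀ D, G.IsACComponent D → ¬ SelfDual (G.ind D) → D = D₀) ∧
    G.K12Kind D₀ ∧ ¬ ContractIsoFix G G.dual D₀

/-- Condition `K3`. -/
def CondK3 (G : Dgraph V) : Prop :=
  G.Cdual = 4 ∧ ∃ D₁ D₂ : Set V, D₁ ≠ D₂ ∧
    (G.IsACComponent D₁ ∧ ¬ SelfDual (G.ind D₁) ∧ G.IsInterval D₁) ∧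
    (G.IsACComponent D₂ ∧ ¬ SelfDual (G.ind D₂) ∧ G.IsInterval D₂)

/-- Condition `K4`. -/
def CondK4 (G : Dgraph V) : Prop :=
  G.Cdual = 5 ∧ ∃ D₁ D₂ : Set V, D₁ ≠ D₂ ∧
    (G.IsACComponent D₁ ∧ ¬ SelfDual (G.ind D₁) ∧ G.IsInterval D₁ ∧ IsPrechain (G.ind D₁)) ∧
    (G.IsACComponent D₂ ∧ ¬ SelfDual (G.ind D₂) ∧ G.IsInterval D₂ ∧ IsPrechain (G.ind D₂))

/-- Condition `K5`. -/
def CondK5 (G : Dgraph V) : Prop :=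
  G.Cdual = 6 ∧ ∃ D₁ D₂ : Set V, D₁ ≠ D₂ ∧
    (G.IsACComponent D₁ ∧ ¬ SelfDual (G.ind D₁) ∧ G.IsInterval D₁ ∧
      DiamondFreeTournament (G.ind D₁)) ∧
    (G.IsACComponent D₂ ∧ ¬ SelfDual (G.ind D₂) ∧ G.IsInterval D₂ ∧
      DiamondFreeTournament (G.ind D₂))

/-- The kind of interval occurring in conditions `L1` and `L2`. -/
def L12Int (G : Dgraph V) (I : Set V) : Prop :=
  G.IsInterval I ∧ DiamondFreeTournament (G.ind I) ∧ ¬ SelfDual (G.ind I) ∧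
    ¬ G.IsACComponent I

/-- Condition `L1`. -/
def CondL1 (G : Dgraph V) : Prop :=
  ∃ I₁ I₂ : Set V, I₁ ≠ I₂ ∧ G.L12Int I₁ ∧ G.L12Int I₂

/-- Condition `L2`. -/
def CondL2 (G : Dgraph V) : Prop :=
  ∃ I₀ : Set V, G.L12Int I₀ ∧ (∀ I, G.L12Int I → I = I₀) ∧ ¬ ContractIsoFix G G.dual I₀

/-- Condition `L3`. -/
def CondL3 (G : Dgraph V) : Prop :=
  G.Cdual = 3 ∧ ∃ D₁ D₂ : Set V, D₁ ≠ D₂ ∧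
    (G.IsACComponent D₁ ∧ ¬ SelfDual (G.ind D₁) ∧ G.IsInterval D₁) ∧
    (G.IsACComponent D₂ ∧ ¬ SelfDual (G.ind D₂) ∧ G.IsInterval D₂) ∧
    ((G.FlagDisjoint D₁ ∧ Cdual (G.ind D₁) = 4 ∧ G.FlagDisjoint D₂ ∧ Cdual (G.ind D₂) = 4) ∨
     (NonTournamentPrechain (G.ind D₁) ∧ G.FlagVertexCond D₁ ∧
      NonTournamentPrechain (G.ind D₂) ∧ G.FlagVertexCond D₂))

/-- Condition `L4`. -/
def CondL4 (G : Dgraph V) : Prop :=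
  G.Cdual = 3 ∧ ∃ D₀ : Set V, G.IsACComponent D₀ ∧ ¬ SelfDual (G.ind D₀) ∧
    (∀ D, G.IsACComponent D → ¬ SelfDual (G.ind D) → D = D₀) ∧
    G.IsInterval D₀ ∧
    ((G.FlagDisjoint D₀ ∧ Cdual (G.ind D₀) = 4) ∨
     (NonTournamentPrechain (G.ind D₀) ∧ G.FlagVertexCond D₀)) ∧
    ¬ ContractIsoFix G G.dual D₀

end Dgraph

open Dgraph

namespace Dgraph

/-- `x → y`: the pair is directed from `x` to `y`. -/
def To {V : Type*} (H : Dgraph V) (x y : V) : Prop := H.Arc x y ∧ ¬ H.Arc y x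

/-- Every induced subdigraph on at most `m` vertices is self-dual. -/
def SelfDualUpTo {V : Type*} (m : ℕ) (H : Dgraph V) : Prop :=
  ∀ X : Set V, X.Finite → X.ncard ≤ m → SelfDual (H.ind X)

section Basic

variable {V : Type*} {W : Type*} {U : Type*} {H : Dgraph V} {K : Dgraph W} {m n : ℕ}

theorem Iso.symm (h : Iso H K) : Iso K H := by
  obtain ⟨e, he⟩ := h
  exact ⟨e.symm, fun x y => by simp [he]⟩

theorem Iso.trans {L : Dgraph U} (h : Iso H K) (h' : Iso K L) : Iso H L := by
  obtain ⟨e, he⟩ := h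
  obtain ⟨e', he'⟩ := h'
  exact ⟨e.trans e', fun x y => by simp [he, he']⟩

theorem Iso.dual (h : Iso H K) : Iso H.dual K.dual := by
  obtain ⟨e, he⟩ := h
  exact ⟨e, fun x y => he y x⟩

theorem SelfDual.dual (h : SelfDual H) : SelfDual H.dual := Iso.dual h

theorem SelfDual.of_iso (h : SelfDual H) (e : Iso H K) : SelfDual K :=
  e.symm.trans (Iso.trans h e.dual)

theorem SelfDual.of_hemi (h : SelfDual H) (e : Hemi H K) : SelfDual K :=
  e.elim h.of_iso h.dual.of_iso

theorem SelfDualUpTo.mono (h : SelfDualUpTo n H) (hmn : m ≤ n) : SelfDualUpTo m H :=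
  fun X hX hc => h X hX (hc.trans hmn)

theorem SelfDualUpTo.dual (h : SelfDualUpTo m H) : SelfDualUpTo m H.dual :=
  fun X hX hc => (h X hX hc).dual

theorem To.ne {x y : V} (h : H.To x y) : x ≠ y := by
  rintro rfl
  exact h.2 h.1

theorem Dir.symm {x y : V} (h : H.Dir x y) : H.Dir y x := Or.symm h

theorem Dir.ne {x y : V} (h : H.Dir x y) : x ≠ y := by
  rcases h with h | h
  · exact To.ne h
  · exact (To.ne h).symm

theorem Neutral.symm {x y : V} (h : H.Neutral x y) : H.Neutral y x :=
  ⟨h.1.symm, fun h' => h.2 h'.symm⟩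

theorem Neutral.arc_comm {x y : V} (h : H.Neutral x y) : H.Arc x y ↔ H.Arc y x := by
  have := h.2
  unfold Dir at this
  tauto

theorem eq_or_dir_or_neutral (H : Dgraph V) (x y : V) : x = y ∨ H.Dir x y ∨ H.Neutral x y := by
  unfold Neutral
  tauto

theorem dual_neutral {x y : V} : H.dual.Neutral x y ↔ H.Neutral x y := by
  simp only [Neutral, Dir, Dgraph.dual]
  tauto

theorem dual_dir {x y : V} : H.dual.Dir x y ↔ H.Dir x y := by
  simp only [Dir, Dgraph.dual]
  tauto

theorem dual_to {x y : V} : H.dual.To x y ↔ H.To y x := Iff.rfl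

theorem dual_aCRel {x y : V} : H.dual.ACRel x y ↔ H.ACRel x y := by
  have : H.dual.Dir = H.Dir := by
    ext x y
    exact dual_dir
  simp only [ACRel, this]

theorem ind_hemi_card {X : Set V} {K : Dgraph (Fin n)} (h : Hemi (H.ind X) K) :
    X.Finite ∧ X.ncard = n := by
  have : Nonempty (X ≃ Fin n) := by
    rcases h with ⟨e, -⟩ | ⟨e, -⟩ <;> exact ⟨e⟩
  obtain ⟨e⟩ := this
  have : Finite X := Finite.of_equiv _ e.symm
  refine ⟨X.toFinite, ?_⟩
  rw [← Nat.card_coe_set_eq, Nat.card_congr e, Nat.card_fin]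

theorem SelfDualUpTo.exists_perm (h : SelfDualUpTo n H) (f : Fin n → V)
    (hf : Function.Injective f) :
    ∃ σ : Equiv.Perm (Fin n), ∀ i j, H.Arc (f i) (f j) ↔ H.Arc (f (σ j)) (f (σ i)) := by
  obtain ⟨e, he⟩ := h (Set.range f) (Set.finite_range f) (by
    rw [← Set.image_univ, Set.ncard_image_of_injective _ hf, Set.ncard_univ, Nat.card_fin])
  let g := Equiv.ofInjective f hf
  have hg : ∀ x : Set.range f, f (g.symm x) = x := fun x =>
    Equiv.apply_ofInjective_symm hf x
  refine ⟨(g.trans e).trans g.symm, fun i j => ?_⟩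
  simp only [Equiv.trans_apply, hg]
  exact he (g i) (g j)

/-- A set of vertices that induces a non-self-dual model is too large. -/
theorem SelfDualUpTo.no_model (h : SelfDualUpTo n H) (M : Fin n → Fin n → Bool)
    (hM : ∀ σ : Equiv.Perm (Fin n), ∃ i j, M i j ≠ M (σ j) (σ i)) (f : Fin n → V)
    (hf : ∀ i j, i < j → f i ≠ f j) (hfM : ∀ i j, H.Arc (f i) (f j) ↔ M i j = true) :
    False := by
  have hinj : Function.Injective f := fun i j hij => by
    rcases lt_trichotomy i j with h | h | h
    · exact absurd hij (hf i j h)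
    · exact h
    · exact absurd hij.symm (hf j i h)
  obtain ⟨σ, hσ⟩ := h.exists_perm f hinj
  obtain ⟨i, j, hij⟩ := hM σ
  apply hij
  rw [Bool.eq_iff_iff, ← hfM, ← hfM]
  exact hσ i j

theorem selfDual_of_param {ι : Type*} (f : ι → V) (hf : Function.Bijective f)
    (σ : Equiv.Perm ι) (h : ∀ i j, H.Arc (f i) (f j) ↔ H.Arc (f (σ j)) (f (σ i))) :
    SelfDual H := by
  let g := Equiv.ofBijective f hf
  have hg : ∀ x, f (g.symm x) = x := fun x => Equiv.ofBijective_apply_symm_apply f hf x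
  refine ⟨(g.symm.trans σ).trans g, fun x y => ?_⟩
  have := h (g.symm x) (g.symm y)
  rw [hg, hg] at this
  exact this

theorem SelfDualUpTo.of_surjective (h : SelfDualUpTo n H) (f : Fin n → V)
    (hf : Function.Surjective f) : SelfDual H := by
  have : Finite V := Finite.of_surjective f hf
  have hc : (Set.univ : Set V).ncard ≤ n := by
    rw [Set.ncard_univ]
    simpa using Nat.card_le_card_of_surjective f hf
  exact (h Set.univ Set.finite_univ hc).of_iso ⟨Equiv.Set.univ V, fun x y => Iff.rfl⟩

end Basic

end Dgraph

namespace Dgraph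
section Small

variable {V : Type*} {H : Dgraph V}

theorem not_isPeak (h : SelfDualUpTo 3 H) (X : Set V) : ¬ IsPeak (H.ind X) := by
  have key : ∀ K : Dgraph (Fin 3), ¬ SelfDual K → ¬ Hemi (H.ind X) K := fun K hK hX =>
    hK ((h X (ind_hemi_card hX).1 (ind_hemi_card hX).2.le).of_hemi hX)
  rintro (hX | hX)
  · refine key _ ?_ hX
    simp only [SelfDual, Iso, Dgraph.dual, peakD1, ofRel]
    decide
  · refine key _ ?_ hX
    simp only [SelfDual, Iso, Dgraph.dual, peakD2, ofRel]
    decide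

theorem not_isDiamond (h : SelfDualUpTo 4 H) (X : Set V) : ¬ IsDiamond (H.ind X) := by
  intro hX
  have := (h X (ind_hemi_card hX).1 (ind_hemi_card hX).2.le).of_hemi hX
  revert this
  simp only [SelfDual, Iso, Dgraph.dual, diamondD, ofRel]
  decide

theorem dir_of_to_to (h : SelfDualUpTo 3 H) {v a b : V} (ha : H.To v a) (hb : H.To v b)
    (hab : a ≠ b) : H.Dir a b := by
  by_contra hd
  have hc := Neutral.arc_comm ⟨hab, hd⟩
  have h1 := ha.ne
  have h2 := hb.ne
  obtain ⟨ha1, ha2⟩ := ha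
  obtain ⟨hb1, hb2⟩ := hb
  by_cases hba : H.Arc b a
  · refine h.no_model ![![false, true, true], ![false, false, true], ![false, true, false]]
      (by decide) ![v, a, b] ?_ ?_
    all_goals simp [Fin.forall_fin_succ, H.irrefl, *]
  · refine h.no_model ![![false, true, true], ![false, false, false], ![false, false, false]]
      (by decide) ![v, a, b] ?_ ?_
    all_goals simp [Fin.forall_fin_succ, H.irrefl, *]

theorem dir_of_to_to' (h : SelfDualUpTo 3 H) {v a b : V} (ha : H.To a v) (hb : H.To b v)
    (hab : a ≠ b) : H.Dir a b :=
  dual_dir.1 (dir_of_to_to h.dual (dual_to.2 ha) (dual_to.2 hb) hab)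

theorem arc_iff_of_neutral (h : SelfDualUpTo 3 H) {x y z : V} (hxy : H.To x y)
    (hx : H.Neutral z x) (hy : H.Neutral z y) : H.Arc z x ↔ H.Arc z y := by
  have h0 := hxy.ne
  have h1 := hx.1
  have h2 := hy.1
  have c1 := hx.arc_comm
  have c2 := hy.arc_comm
  obtain ⟨ha1, ha2⟩ := hxy
  by_contra hc
  by_cases hzx : H.Arc z x
  · have hzy : ¬ H.Arc z y := by tauto
    rw [c1] at hzx
    rw [c2] at hzy
    refine h.no_model ![![false, true, false], ![true, false, true], ![false, false, false]]
      (by decide) ![z, x, y] ?_ ?_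
    all_goals simp [Fin.forall_fin_succ, H.irrefl, *]
  · have hzy : H.Arc z y := by tauto
    rw [c1] at hzx
    rw [c2] at hzy
    refine h.no_model ![![false, false, true], ![false, false, true], ![true, false, false]]
      (by decide) ![z, x, y] ?_ ?_
    all_goals simp [Fin.forall_fin_succ, H.irrefl, *]

theorem no_out_diamond (h : SelfDualUpTo 4 H) {v x y z : V} (hx : H.To v x) (hy : H.To v y)
    (hz : H.To v z) (hxy : H.To x y) (hyz : H.To y z) : ¬ H.To z x := by
  intro hzx
  have := hx.ne
  have := hy.ne
  have := hz.ne
  have := hxy.ne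
  have := hyz.ne
  have := hzx.ne.symm
  simp only [To] at hx hy hz hxy hyz hzx
  refine h.no_model ![![false, true, true, true], ![false, false, true, false],
    ![false, false, false, true], ![false, true, false, false]] (by decide) ![v, x, y, z] ?_ ?_
  all_goals simp [Fin.forall_fin_succ, H.irrefl, *]

theorem no_in_diamond (h : SelfDualUpTo 4 H) {v x y z : V} (hx : H.To x v) (hy : H.To y v)
    (hz : H.To z v) (hxy : H.To x y) (hyz : H.To y z) : ¬ H.To z x := by
  intro hzx
  exact no_out_diamond h.dual (dual_to.2 hx) (dual_to.2 hz) (dual_to.2 hy) (dual_to.2 hzx)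
    (dual_to.2 hyz) (dual_to.2 hxy)

/-- A directed pair with a neutral third vertex cannot be attached to both. -/
theorem not_pendant_to (h : SelfDualUpTo 4 H) {w r p q : V} (hwr : H.To w r)
    (hrp : H.Dir r p) (hrq : H.Dir r q) (hpq : H.To p q) (hp : H.Neutral w p)
    (hq : H.Neutral w q) : False := by
  have h3 := h.mono (by norm_num : 3 ≤ 4)
  have n1 := hwr.ne
  have n4 := hpq.ne
  have n5 := hp.1
  have n6 := hq.1
  have c0 := arc_iff_of_neutral h3 hpq hp hq
  have c1 := hp.arc_comm
  have c2 := hq.arc_comm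
  have hrp' : H.To r p := by
    rcases hrp with hrp | hrp
    · exact hrp
    · exact absurd (dir_of_to_to' h3 hwr hrp n5) hp.2
  have hrq' : H.To r q := by
    rcases hrq with hrq | hrq
    · exact hrq
    · exact absurd (dir_of_to_to' h3 hwr hrq n6) hq.2
  have n2 := hrp'.ne
  have n3 := hrq'.ne
  simp only [To] at hwr hrp' hrq' hpq
  by_cases hwp : H.Arc w p
  · have hpw := c1.1 hwp
    have hwq := c0.1 hwp
    have hqw := c2.1 hwq
    refine h.no_model ![![false, true, true, true], ![false, false, true, true],
      ![true, false, false, true], ![true, false, false, false]] (by decide)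
      ![w, r, p, q] ?_ ?_
    all_goals simp only [Fin.forall_fin_succ, Matrix.cons_val_zero, Matrix.cons_val_succ]
    all_goals simp [H.irrefl, *]
  · have hpw := mt c1.2 hwp
    have hwq := mt c0.2 hwp
    have hqw := mt c2.2 hwq
    refine h.no_model ![![false, true, false, false], ![false, false, true, true],
      ![false, false, false, true], ![false, false, false, false]] (by decide)
      ![w, r, p, q] ?_ ?_
    all_goals simp only [Fin.forall_fin_succ, Matrix.cons_val_zero, Matrix.cons_val_succ]
    all_goals simp [H.irrefl, *]

theorem not_pendant (h : SelfDualUpTo 4 H) {w r p q : V} (hwr : H.Dir w r)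
    (hrp : H.Dir r p) (hrq : H.Dir r q) (hpq : H.Dir p q) (hp : H.Neutral w p)
    (hq : H.Neutral w q) : False := by
  have key : ∀ {K : Dgraph V}, SelfDualUpTo 4 K → K.To w r → K.Dir r p → K.Dir r q →
      K.Dir p q → K.Neutral w p → K.Neutral w q → False := by
    intro K h hwr hrp hrq hpq hp hq
    rcases hpq with hpq | hpq
    · exact not_pendant_to h hwr hrp hrq hpq hp hq
    · exact not_pendant_to h hwr hrq hrp hpq hq hp
  rcases hwr with hwr | hwr
  · exact key h hwr hrp hrq hpq hp hq
  · exact key h.dual (dual_to.2 hwr) (dual_dir.2 hrp) (dual_dir.2 hrq) (dual_dir.2 hpq)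
      (dual_neutral.2 hp) (dual_neutral.2 hq)

/-- Once three vertices are pairwise directed, everything is directed to two of them. -/
theorem two_dir_of_triple (h : SelfDualUpTo 4 H) (hconn : ∀ x y, H.ACRel x y) {a b c : V}
    (hab : H.Dir a b) (hbc : H.Dir b c) (hac : H.Dir a c) (w : V) :
    (H.Dir w a ∧ H.Dir w b) ∨ (H.Dir w b ∧ H.Dir w c) ∨ (H.Dir w a ∧ H.Dir w c) := by
  have step : ∀ {a b c w w' : V}, H.Dir a b → H.Dir b c → H.Dir a c → H.Dir w w' →
      H.Dir w a → H.Dir w b →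
      (H.Dir w' a ∧ H.Dir w' b) ∨ (H.Dir w' b ∧ H.Dir w' c) ∨ (H.Dir w' a ∧ H.Dir w' c) := by
    intro a b c w w' hab hbc hac hww hwa hwb
    rcases eq_or_dir_or_neutral H w' a with rfl | ha | ha
    · exact Or.inr (Or.inl ⟨hab, hac⟩)
    · rcases eq_or_dir_or_neutral H w' b with rfl | hb | hb
      · exact Or.inr (Or.inr ⟨ha, hbc⟩)
      · exact Or.inl ⟨ha, hb⟩
      · rcases eq_or_dir_or_neutral H w' c with rfl | hc | hc
        · exact Or.inl ⟨hac.symm, hbc.symm⟩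
        · exact Or.inr (Or.inr ⟨ha, hc⟩)
        · exact (not_pendant h ha hab hac hbc hb hc).elim
    · rcases eq_or_dir_or_neutral H w' b with rfl | hb | hb
      · exact Or.inr (Or.inr ⟨hab.symm, hbc⟩)
      · rcases eq_or_dir_or_neutral H w' c with rfl | hc | hc
        · exact Or.inl ⟨hac.symm, hbc.symm⟩
        · exact Or.inr (Or.inl ⟨hb, hc⟩)
        · exact (not_pendant h hb hab.symm hbc hac ha hc).elim
      · exact (not_pendant h hww.symm hwa hwb hab ha hb).elim
  have := hconn a w
  induction this with
  | refl => exact Or.inr (Or.inl ⟨hab, hac⟩)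
  | tail _ hww ih =>
    rcases ih with ⟨h1, h2⟩ | ⟨h1, h2⟩ | ⟨h1, h2⟩
    · exact step hab hbc hac hww h1 h2
    · have := step hbc hac.symm hab.symm hww h1 h2
      tauto
    · have := step hac hbc.symm hab hww h1 h2
      tauto

theorem neutral_unique_of_triple (h : SelfDualUpTo 4 H) (hconn : ∀ x y, H.ACRel x y)
    {a b c : V} (hab : H.Dir a b) (hbc : H.Dir b c) (hac : H.Dir a c) {x y z : V}
    (hy : H.Neutral x y) (hz : H.Neutral x z) : y = z := by
  have h3 := h.mono (by norm_num : 3 ≤ 4)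
  by_contra hyz
  obtain ⟨p, q, hxp, hxq, hpq⟩ : ∃ p q, H.Dir x p ∧ H.Dir x q ∧ H.Dir p q := by
    rcases two_dir_of_triple h hconn hab hbc hac x with ⟨h1, h2⟩ | ⟨h1, h2⟩ | ⟨h1, h2⟩
    exacts [⟨_, _, h1, h2, hab⟩, ⟨_, _, h1, h2, hbc⟩, ⟨_, _, h1, h2, hac⟩]
  have hdir : ∀ {t}, H.Neutral x t → H.Dir t p := by
    intro t ht
    have hn := ht.symm.2
    rcases two_dir_of_triple h hconn hxp hpq hxq t with h1 | h1 | h1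
    exacts [h1.2, h1.1, absurd h1.1 hn]
  have hyzd : H.Dir y z := by
    have ny := hy.2
    have nz := hz.2
    rcases hxp with hxp | hxp
    · rcases hdir hy with h1 | h1
      · exact absurd (dir_of_to_to' h3 hxp h1 hy.1) ny
      · rcases hdir hz with h2 | h2
        · exact absurd (dir_of_to_to' h3 hxp h2 hz.1) nz
        · exact dir_of_to_to h3 h1 h2 hyz
    · rcases hdir hy with h1 | h1
      · rcases hdir hz with h2 | h2
        · exact dir_of_to_to' h3 h1 h2 hyz
        · exact absurd (dir_of_to_to h3 hxp h2 hz.1) nz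
      · exact absurd (dir_of_to_to h3 hxp h1 hy.1) ny
  exact not_pendant h hxp (hdir hy).symm (hdir hz).symm hyzd hy hz

end Small
end Dgraph

namespace Dgraph
section Path

variable {V : Type*} {H : Dgraph V}

theorem to_right_unique (h : SelfDualUpTo 3 H)
    (hT : ∀ a b c, H.Dir a b → H.Dir b c → ¬ H.Dir a c) {x y z : V} (hy : H.To x y)
    (hz : H.To x z) : y = z := by
  by_contra hyz
  exact hT x y z (Or.inl hy) (dir_of_to_to h hy hz hyz) (Or.inl hz)

theorem to_left_unique (h : SelfDualUpTo 3 H)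
    (hT : ∀ a b c, H.Dir a b → H.Dir b c → ¬ H.Dir a c) {x y z : V} (hy : H.To y x)
    (hz : H.To z x) : y = z := by
  by_contra hyz
  exact hT x y z (Or.inr hy) (dir_of_to_to' h hy hz hyz) (Or.inr hz)

theorem seq_ne (h : SelfDualUpTo 3 H) (hT : ∀ a b c, H.Dir a b → H.Dir b c → ¬ H.Dir a c)
    {u : ℕ → V} {N : ℕ} (hu : ∀ i < N, H.To (u i) (u (i + 1))) (h0 : ∀ x, ¬ H.To x (u 0))
    {i j : ℕ} (hij : i < j) (hj : j ≤ N) : u i ≠ u j := by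
  induction i generalizing j with
  | zero =>
    obtain ⟨j, rfl⟩ : ∃ j', j = j' + 1 := ⟨j - 1, by omega⟩
    intro he
    exact h0 (u j) (he ▸ hu j (by omega))
  | succ i ih =>
    obtain ⟨j, rfl⟩ : ∃ j', j = j' + 1 := ⟨j - 1, by omega⟩
    intro he
    have h1 := hu i (by omega)
    rw [he] at h1
    exact ih (by omega) (by omega) (to_left_unique h hT h1 (hu j (by omega)))

theorem seq_inj (h : SelfDualUpTo 3 H) (hT : ∀ a b c, H.Dir a b → H.Dir b c → ¬ H.Dir a c)
    {u : ℕ → V} {N : ℕ} (hu : ∀ i < N, H.To (u i) (u (i + 1))) (h0 : ∀ x, ¬ H.To x (u 0))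
    {i j : ℕ} (hi : i ≤ N) (hj : j ≤ N) (hij : u i = u j) : i = j := by
  rcases lt_trichotomy i j with hlt | he | hlt
  · exact absurd hij (seq_ne h hT hu h0 hlt hj)
  · exact he
  · exact absurd hij.symm (seq_ne h hT hu h0 hlt hi)

theorem seq_to (h : SelfDualUpTo 3 H) (hT : ∀ a b c, H.Dir a b → H.Dir b c → ¬ H.Dir a c)
    {u : ℕ → V} {N : ℕ} (hu : ∀ i < N, H.To (u i) (u (i + 1))) (h0 : ∀ x, ¬ H.To x (u 0))
    {i j : ℕ} (hi : i ≤ N) (hj : j ≤ N) (hij : H.To (u i) (u j)) : j = i + 1 := by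
  rcases j with _ | j
  · exact absurd hij (h0 _)
  · have := to_left_unique h hT hij (hu j (by omega))
    rw [seq_inj h hT hu h0 hi (by omega) this]

theorem seq_neutral (h : SelfDualUpTo 3 H)
    (hT : ∀ a b c, H.Dir a b → H.Dir b c → ¬ H.Dir a c)
    {u : ℕ → V} {N : ℕ} (hu : ∀ i < N, H.To (u i) (u (i + 1))) (h0 : ∀ x, ¬ H.To x (u 0))
    {i j : ℕ} (hij : i + 2 ≤ j) (hj : j ≤ N) : H.Neutral (u i) (u j) := by
  refine ⟨fun he => ?_, ?_⟩
  · have := seq_inj h hT hu h0 (by omega) hj he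
    omega
  · rintro (hd | hd)
    · have := seq_to h hT hu h0 (by omega) hj hd
      omega
    · have := seq_to h hT hu h0 hj (by omega) hd
      omega

theorem seq_type (h : SelfDualUpTo 3 H) (hT : ∀ a b c, H.Dir a b → H.Dir b c → ¬ H.Dir a c)
    {u : ℕ → V} {N : ℕ} (hu : ∀ i < N, H.To (u i) (u (i + 1))) (h0 : ∀ x, ¬ H.To x (u 0))
    {i j : ℕ} (hij : i + 2 ≤ j) (hj : j ≤ N) : H.Arc (u i) (u j) ↔ H.Arc (u 0) (u 2) := by
  have hn : ∀ {i j}, i + 2 ≤ j → j ≤ N → H.Neutral (u i) (u j) :=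
    fun h1 h2 => seq_neutral h hT hu h0 h1 h2
  induction i with
  | zero =>
    induction j, hij using Nat.le_induction with
    | base => rfl
    | succ j hij' ih =>
      exact (arc_iff_of_neutral h (hu j (by omega)) (hn (by omega) (by omega))
        (hn (by omega) (by omega))).symm.trans (ih (by omega))
  | succ i ih =>
    refine Iff.trans ?_ (ih (by omega))
    rw [(hn (by omega) hj).arc_comm, (hn (i := i) (by omega) hj).arc_comm,
      arc_iff_of_neutral h (hu i (by omega)) (hn (by omega) (by omega)).symm
        (hn (by omega) (by omega)).symm]

theorem seq_arc (h : SelfDualUpTo 3 H) (hT : ∀ a b c, H.Dir a b → H.Dir b c → ¬ H.Dir a c)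
    {u : ℕ → V} {N : ℕ} (hu : ∀ i < N, H.To (u i) (u (i + 1))) (h0 : ∀ x, ¬ H.To x (u 0))
    {i j : ℕ} (hi : i ≤ N) (hj : j ≤ N) :
    H.Arc (u i) (u j) ↔ (i + 1 = j ∨ (H.Arc (u 0) (u 2) ∧ (i + 1 < j ∨ j + 1 < i))) := by
  have key : ∀ {i j}, i < j → j ≤ N → ((H.Arc (u i) (u j) ↔
      (i + 1 = j ∨ (H.Arc (u 0) (u 2) ∧ (i + 1 < j ∨ j + 1 < i)))) ∧ (H.Arc (u j) (u i) ↔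
      (j + 1 = i ∨ (H.Arc (u 0) (u 2) ∧ (j + 1 < i ∨ i + 1 < j))))) := by
    intro i j hij hj
    rcases Nat.lt_or_ge (i + 1) j with h1 | h1
    · have h2 := seq_type h hT hu h0 h1 hj
      have h3 := (seq_neutral h hT hu h0 h1 hj).arc_comm
      have h4 : ¬ j + 1 = i := by omega
      have h5 : ¬ i + 1 = j := by omega
      tauto
    · obtain rfl : j = i + 1 := by omega
      have h2 := hu i (by omega)
      simp [h2.1, h2.2]
      omega
  rcases lt_trichotomy i j with hij | rfl | hij
  · exact (key hij hj).1
  · simp [H.irrefl]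
  · exact (key hij hi).2

theorem selfDual_or_consec_of_source (h : SelfDualUpTo 3 H)
    (hT : ∀ a b c, H.Dir a b → H.Dir b c → ¬ H.Dir a c) (hconn : ∀ x y, H.ACRel x y)
    {v : V} (hv : ∀ x, ¬ H.To x v) : SelfDual H ∨ ∃ full, Iso H (consecNat full) := by
  classical
  let s : V → V := fun x => if hx : ∃ y, H.To x y then hx.choose else x
  have hs : ∀ x y, H.To x y → H.To x (s x) := by
    intro x y hxy
    have hx : ∃ y, H.To x y := ⟨y, hxy⟩
    simp only [s, dif_pos hx]
    exact hx.choose_spec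
  let u : ℕ → V := fun i => s^[i] v
  have hus : ∀ i, u (i + 1) = s (u i) := fun i => Function.iterate_succ_apply' s i v
  have h0 : ∀ x, ¬ H.To x (u 0) := hv
  have hstep : ∀ i y, H.To (u i) y → H.To (u i) (u (i + 1)) := by
    intro i y hy
    rw [hus]
    exact hs _ _ hy
  by_cases hsink : ∃ n, ∀ y, ¬ H.To (u n) y
  · left
    let N := Nat.find hsink
    have hN : ∀ y, ¬ H.To (u N) y := Nat.find_spec hsink
    have hu : ∀ i < N, H.To (u i) (u (i + 1)) := by
      intro i hi
      have := Nat.find_min hsink hi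
      push Not at this
      obtain ⟨y, hy⟩ := this
      exact hstep i y hy
    have hsurj : ∀ y, ∃ i ≤ N, u i = y := by
      intro y
      have := hconn v y
      induction this with
      | refl => exact ⟨0, by omega, rfl⟩
      | @tail y z _ hyz ih =>
        obtain ⟨i, hi, rfl⟩ := ih
        rcases hyz with hyz | hyz
        · have hiN : i ≠ N := by
            rintro rfl
            exact hN _ hyz
          exact ⟨i + 1, by omega, to_right_unique h hT (hu i (by omega)) hyz⟩
        · rcases i with _ | i
          · exact absurd hyz (h0 _)
          · exact ⟨i, by omega, to_left_unique h hT (hu i (by omega)) hyz⟩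
    refine selfDual_of_param (fun i : Fin (N + 1) => u i) ⟨fun i j hij => ?_, fun y => ?_⟩
      Fin.revPerm fun i j => ?_
    · exact Fin.ext (seq_inj h hT hu h0 (by omega) (by omega) hij)
    · obtain ⟨i, hi, rfl⟩ := hsurj y
      exact ⟨⟨i, by omega⟩, rfl⟩
    · change H.Arc (u i) (u j) ↔ H.Arc (u (Fin.rev j)) (u (Fin.rev i))
      have e1 := seq_arc h hT hu h0 (i := i) (j := j) (by omega) (by omega)
      have e2 := seq_arc h hT hu h0 (i := Fin.rev j) (j := Fin.rev i) (by omega) (by omega)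
      rw [e1, e2]
      simp only [Fin.val_rev]
      have h1 : (i : ℕ) + 1 = j ↔ N + 1 - (j + 1) + 1 = N + 1 - ((i : ℕ) + 1) := by omega
      have h2 : (i : ℕ) + 1 < j ↔ N + 1 - (j + 1) + 1 < N + 1 - ((i : ℕ) + 1) := by omega
      have h3 : (j : ℕ) + 1 < i ↔ N + 1 - (i + 1) + 1 < N + 1 - ((j : ℕ) + 1) := by omega
      rw [h1, h2, h3]
  · right
    push Not at hsink
    have hu : ∀ i, H.To (u i) (u (i + 1)) := fun i => hstep i _ (hsink i).choose_spec
    have hsurj : Function.Surjective u := by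
      intro y
      have := hconn v y
      induction this with
      | refl => exact ⟨0, rfl⟩
      | @tail y z _ hyz ih =>
        obtain ⟨i, rfl⟩ := ih
        rcases hyz with hyz | hyz
        · exact ⟨i + 1, to_right_unique h hT (hu i) hyz⟩
        · rcases i with _ | i
          · exact absurd hyz (h0 _)
          · exact ⟨i, to_left_unique h hT (hu i) hyz⟩
    have hinj : Function.Injective u := fun i j hij =>
      seq_inj h hT (N := max i j) (fun i _ => hu i) h0 (le_max_left i j) (le_max_right i j) hij
    refine ⟨decide (H.Arc (u 0) (u 2)), Iso.symm ⟨Equiv.ofBijective u ⟨hinj, hsurj⟩, ?_⟩⟩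
    intro i j
    change (consecNat _).Arc i j ↔ H.Arc (u i) (u j)
    rw [seq_arc h hT (N := max i j) (fun i _ => hu i) h0 (le_max_left i j) (le_max_right i j)]
    simp only [consecNat, ofRel, decide_eq_true_eq]
    constructor
    · rintro ⟨-, hh⟩
      exact hh
    · intro hh
      exact ⟨by omega, hh⟩

theorem selfDual_of_no_ends (h : SelfDualUpTo 4 H)
    (hT : ∀ a b c, H.Dir a b → H.Dir b c → ¬ H.Dir a c) (hconn : ∀ x y, H.ACRel x y)
    (hout : ∀ x, ∃ y, H.To x y) (hin : ∀ y, ∃ x, H.To x y) : SelfDual H := by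
  classical
  have h3 := h.mono (by norm_num : 3 ≤ 4)
  choose s hs using hout
  have hs' : ∀ {x y}, H.To x y → s x = y := fun hxy => to_right_unique h3 hT (hs _) hxy
  have hbij : Function.Bijective s := by
    refine ⟨fun x y hxy => ?_, fun y => ?_⟩
    · have := hs x
      rw [hxy] at this
      exact to_left_unique h3 hT this (hs y)
    · obtain ⟨x, hx⟩ := hin y
      exact ⟨x, hs' hx⟩
  by_cases h4 : ∃ x, s (s (s (s x))) = x
  · obtain ⟨x, hx⟩ := h4
    refine h.of_surjective ![x, s x, s (s x), s (s (s x))] fun y => ?_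
    have := hconn x y
    induction this with
    | refl => exact ⟨0, rfl⟩
    | @tail y z _ hyz ih =>
      obtain ⟨i, rfl⟩ := ih
      rcases hyz with hyz | hyz
      · refine ⟨i + 1, ?_⟩
        rw [← hs' hyz]
        fin_cases i <;> simp [hx]
      · refine ⟨i - 1, hbij.1 ?_⟩
        rw [hs' hyz]
        fin_cases i <;> simp [hx]
  · push Not at h4
    have haut : ∀ x y, H.Arc x y ↔ H.Arc (s x) (s y) := by
      intro x y
      have hto : ∀ {x y}, H.To x y ↔ H.To (s x) (s y) := by
        intro x y
        constructor
        · intro hxy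
          rw [← hs' hxy]
          exact hs _
        · intro hxy
          rw [← hbij.1 (hs' hxy)]
          exact hs _
      rcases eq_or_dir_or_neutral H x y with rfl | (hd | hd) | hn
      · simp [H.irrefl]
      · exact iff_of_true hd.1 (hto.1 hd).1
      · exact iff_of_false hd.2 (hto.1 hd).2
      have hn' : H.Neutral (s x) (s y) := by
        refine ⟨fun he => hn.1 (hbij.1 he), ?_⟩
        rintro (hd | hd)
        · exact hn.2 (Or.inl (hto.2 hd))
        · exact hn.2 (Or.inr (hto.2 hd))
      have hone : ∀ {x y}, H.Neutral x y → H.Neutral (s x) (s y) → H.Neutral (s x) y →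
          (H.Arc x y ↔ H.Arc (s x) (s y)) := by
        intro x y hxy hsxy hm
        rw [hxy.arc_comm, arc_iff_of_neutral h3 (hs x) hxy.symm hm.symm, hm.symm.arc_comm,
          arc_iff_of_neutral h3 (hs y) hm hsxy]
      rcases eq_or_dir_or_neutral H (s x) y with he | (hd | hd) | hm
      · exact absurd (Or.inl (he ▸ hs x)) hn.2
      · rcases eq_or_dir_or_neutral H (s y) x with he | (hd' | hd') | hm
        · exact absurd (Or.inr (he ▸ hs y)) hn.2
        · have e1 := hs' hd
          have e2 := hs' hd'
          exact absurd (by rw [e1, e2]) (h4 x)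
        · exact absurd (hbij.1 (hs' hd')) hn.1
        · rw [hn.arc_comm, hn'.arc_comm]
          exact hone hn.symm hn'.symm hm
      · exact absurd (hbij.1 (hs' hd)).symm hn.1
      · exact hone hn hn' hm
    let p : Equiv.Perm V := Equiv.ofBijective s hbij
    have hp : ∀ x, p x = s x := fun _ => rfl
    have hpz : ∀ (m : ℤ) x y, H.Arc x y ↔ H.Arc ((p ^ m) x) ((p ^ m) y) := by
      intro m
      induction m using Int.induction_on with
      | zero => simp
      | succ m ih =>
        intro x y
        rw [ih, haut, add_comm, zpow_add]
        rfl
      | pred m ih =>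
        intro x y
        rw [ih, haut ((p ^ (-(m : ℤ) - 1)) x), ← hp, ← hp, ← Equiv.Perm.mul_apply,
          ← Equiv.Perm.mul_apply, ← zpow_one_add]
        simp
    rcases isEmpty_or_nonempty V with hV | ⟨⟨v⟩⟩
    · exact ⟨Equiv.refl V, fun x => (hV.false x).elim⟩
    have horb : ∀ y, ∃ k : ℤ, (p ^ k) v = y := by
      intro y
      have := hconn v y
      induction this with
      | refl => exact ⟨0, rfl⟩
      | @tail y z _ hyz ih =>
        obtain ⟨k, rfl⟩ := ih
        rcases hyz with hyz | hyz
        · exact ⟨1 + k, by rw [zpow_one_add, Equiv.Perm.mul_apply, hp, hs' hyz]⟩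
        · refine ⟨k - 1, p.injective ?_⟩
          rw [hp z, hs' hyz, ← Equiv.Perm.mul_apply, ← zpow_one_add]
          simp
    choose k hk using horb
    have hneg : ∀ l : ℤ, (p ^ (-k ((p ^ l) v))) v = (p ^ (-l)) v := by
      intro l
      have h1 := hk ((p ^ l) v)
      set a := k ((p ^ l) v)
      have : (p ^ (-l - a)) ((p ^ a) v) = (p ^ (-l - a)) ((p ^ l) v) := by rw [h1]
      rw [← Equiv.Perm.mul_apply, ← Equiv.Perm.mul_apply, ← zpow_add, ← zpow_add] at this
      rw [show -l - a + a = -l by ring, show -l - a + l = -a by ring] at this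
      exact this.symm
    let f : V → V := fun y => (p ^ (-k y)) v
    have hf : ∀ l : ℤ, f ((p ^ l) v) = (p ^ (-l)) v := hneg
    have hinv : Function.Involutive f := by
      intro y
      have : f (f ((p ^ k y) v)) = (p ^ k y) v := by
        rw [hf (k y), hf (-k y), neg_neg]
      rwa [hk] at this
    have key : ∀ a b : ℤ, H.Arc ((p ^ a) v) ((p ^ b) v) ↔
        H.Arc (f ((p ^ b) v)) (f ((p ^ a) v)) := by
      intro a b
      rw [hf, hf, hpz (-a - b), ← Equiv.Perm.mul_apply, ← Equiv.Perm.mul_apply, ← zpow_add,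
        ← zpow_add]
      rw [show -a - b + a = -b by ring, show -a - b + b = -a by ring]
    refine ⟨hinv.toPerm, fun x y => ?_⟩
    have := key (k x) (k y)
    rwa [hk, hk] at this

theorem selfDual_or_consec_of_no_triple (h : SelfDualUpTo 4 H)
    (hT : ∀ a b c, H.Dir a b → H.Dir b c → ¬ H.Dir a c) (hconn : ∀ x y, H.ACRel x y) :
    SelfDual H ∨ H.OneEndInfiniteConsecutivity := by
  have h3 := h.mono (by norm_num : 3 ≤ 4)
  by_cases hin : ∀ y, ∃ x, H.To x y
  · by_cases hout : ∀ x, ∃ y, H.To x y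
    · exact Or.inl (selfDual_of_no_ends h hT hconn hout hin)
    · push Not at hout
      obtain ⟨v, hv⟩ := hout
      have hT' : ∀ a b c, H.dual.Dir a b → H.dual.Dir b c → ¬ H.dual.Dir a c := by
        intro a b c
        rw [dual_dir, dual_dir, dual_dir]
        exact hT a b c
      rcases selfDual_or_consec_of_source h3.dual hT' (fun x y => dual_aCRel.2 (hconn x y))
        (v := v) hv with hd | ⟨full, hd⟩
      · exact Or.inl hd.dual
      · exact Or.inr ⟨full, Or.inr hd.dual⟩
  · push Not at hin
    obtain ⟨v, hv⟩ := hin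
    rcases selfDual_or_consec_of_source h3 hT hconn hv with hd | ⟨full, hd⟩
    · exact Or.inl hd
    · exact Or.inr ⟨full, Or.inl hd⟩

/-- An arc-connected digraph that is self-dual on all sets of at most four vertices. -/
theorem prechain_or_selfDual_or_consec (h : SelfDualUpTo 4 H) (hconn : ∀ x y, H.ACRel x y) :
    H.IsPrechain ∨ SelfDual H ∨ H.OneEndInfiniteConsecutivity := by
  by_cases hT : ∀ a b c, H.Dir a b → H.Dir b c → ¬ H.Dir a c
  · exact Or.inr (selfDual_or_consec_of_no_triple h hT hconn)
  · push Not at hT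
    obtain ⟨a, b, c, hab, hbc, hac⟩ := hT
    refine Or.inl ⟨not_isPeak (h.mono (by norm_num)), not_isDiamond h, ?_⟩
    rintro ⟨x, y, z, hyz, hy, hz⟩
    exact hyz (neutral_unique_of_triple h hconn hab hbc hac hy hz)

end Path
end Dgraph

namespace Dgraph
section Chain

variable {V : Type*} {H : Dgraph V}

theorem IsChainD.selfDual [Finite V] (hH : H.IsChainD) : SelfDual H := by
  classical
  have : IsStrictTotalOrder V H.Arc :=
    { irrefl := H.irrefl
      trans := hH.2
      trichotomous := fun x y hxy hyx => by
        by_contra hne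
        rcases hH.1 x y hne with hd | hd
        · exact hxy hd.1
        · exact hyx hd.1 }
  let : LinearOrder V := linearOrderOfSTO H.Arc
  have := Fintype.ofFinite V
  let e := Fintype.orderIsoFinOfCardEq V rfl
  refine ⟨(e.symm.toEquiv.trans Fin.revPerm).trans e.toEquiv, fun x y => ?_⟩
  change x < y ↔ e (Fin.rev (e.symm y)) < e (Fin.rev (e.symm x))
  rw [e.lt_iff_lt, Fin.rev_lt_rev, e.symm.lt_iff_lt]

/-- There is no infinite interval inducing a chain. -/
def NoInfiniteChainInterval (H : Dgraph V) : Prop :=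
  ∀ I : Set V, I.Infinite → H.IsInterval I → ¬ (H.ind I).IsChainD

theorem NoInfiniteChainInterval.selfDual_of_isChainD (hH : H.NoInfiniteChainInterval)
    (hc : H.IsChainD) : SelfDual H := by
  rcases finite_or_infinite V with hV | hV
  · exact hc.selfDual
  · refine absurd ?_ (hH Set.univ Set.infinite_univ fun x hx => absurd (Set.mem_univ x) hx)
    exact ⟨fun x y hxy => hc.1 x y fun he => hxy (Subtype.ext he),
      fun x y z hxy hyz => hc.2 x y z hxy hyz⟩

/-- Two vertices capping a chain from both sides, in whatever mutual relation. -/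
theorem NoInfiniteChainInterval.selfDual_of_caps (hH : H.NoInfiniteChainInterval) {a b : V}
    (hab : a ≠ b) (P : Set V) (hP : ∀ p, p ∈ P ↔ p ≠ a ∧ p ≠ b)
    (ha : ∀ p ∈ P, H.To a p) (hb : ∀ p ∈ P, H.To p b) (hc : (H.ind P).IsChainD) :
    SelfDual H := by
  classical
  have hfin : P.Finite := by
    by_contra hinf
    refine hH P hinf (fun x hx => ?_) hc
    rw [hP] at hx
    by_cases hxa : x = a
    · subst hxa
      exact Or.inl ha
    · have : x = b := by tauto
      subst this
      exact Or.inr (Or.inl hb)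
  have : Finite P := hfin
  obtain ⟨σ, hσ⟩ := hc.selfDual
  have haP : a ∉ P := fun h => ((hP a).1 h).1 rfl
  have hbP : b ∉ P := fun h => ((hP b).1 h).2 rfl
  let f : Option (Option P) → V := fun o => o.elim a fun o => o.elim b fun p => p
  let τ : Equiv.Perm (Option (Option P)) :=
    (Equiv.swap none (some none)) * (Equiv.optionCongr (Equiv.optionCongr σ))
  refine selfDual_of_param f ⟨?_, ?_⟩ τ ?_
  · rintro (_ | _ | p) (_ | _ | q) h
    · rfl
    · exact absurd h hab
    · exact absurd q.2 fun hq => haP (by rwa [show a = q from h])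
    · exact absurd h hab.symm
    · rfl
    · exact absurd q.2 fun hq => hbP (by rwa [show b = q from h])
    · exact absurd p.2 fun hp => haP (by rwa [← show (p : V) = a from h])
    · exact absurd p.2 fun hp => hbP (by rwa [← show (p : V) = b from h])
    · exact congrArg _ (congrArg _ (Subtype.ext h))
  · intro v
    by_cases hva : v = a
    · exact ⟨none, hva.symm⟩
    by_cases hvb : v = b
    · exact ⟨some none, hvb.symm⟩
    exact ⟨some (some ⟨v, (hP v).2 ⟨hva, hvb⟩⟩), rfl⟩
  · have h1 : τ none = some none := by simp [τ]
    have h2 : τ (some none) = none := by simp [τ]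
    have h3 : ∀ p, τ (some (some p)) = some (some (σ p)) := fun p => by
      simp only [τ, Equiv.Perm.mul_apply, Equiv.optionCongr_apply, Option.map_some]
      exact Equiv.swap_apply_of_ne_of_ne (by simp) (by simp)
    have ha' := fun p : P => ha p p.2
    have hb' := fun p : P => hb p p.2
    rintro (_ | _ | p) (_ | _ | q)
    · simp only [h1, f]
      exact iff_of_false (H.irrefl _) (H.irrefl _)
    · simp only [h1, h2]
    · simp only [h1, h3]
      exact iff_of_true (ha' q).1 (hb' (σ q)).1
    · simp only [h1, h2]
    · simp only [h2]
      exact iff_of_false (H.irrefl _) (H.irrefl _)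
    · simp only [h2, h3]
      exact iff_of_false (hb' q).2 (ha' (σ q)).2
    · simp only [h1, h3]
      exact iff_of_false (ha' p).2 (hb' (σ p)).2
    · simp only [h2, h3]
      exact iff_of_true (hb' p).1 (ha' (σ p)).1
    · simp only [h3]
      exact hσ p q

end Chain

section Consec

/-- Reversal of the maximal blocks of a set of naturals below a bound. -/
theorem exists_block_reversal (X : Set ℕ) (N : ℕ) : ∃ φ : ℕ → ℕ,
    (∀ x ∈ X, x < N → φ x ∈ X ∧ φ x < N ∧ φ (φ x) = x) ∧
    (∀ x ∈ X, ∀ y ∈ X, x < N → y < N → y = x + 1 → φ x = φ y + 1) := by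
  classical
  induction N using Nat.strong_induction_on with
  | _ N ih =>
    have hex : ∃ l, ∀ x, l ≤ x → x < N → x ∈ X := ⟨N, fun x h1 h2 => by omega⟩
    obtain ⟨l, hl, hmin⟩ : ∃ l, (∀ x, l ≤ x → x < N → x ∈ X) ∧
        ∀ m < l, ¬ ∀ x, m ≤ x → x < N → x ∈ X :=
      ⟨Nat.find hex, Nat.find_spec hex, fun m hm => Nat.find_min hex hm⟩
    have hlN : l ≤ N := by
      by_contra h
      exact hmin N (by omega) fun x h1 h2 => by omega
    rcases l with _ | l
    · refine ⟨fun x => N - 1 - x, fun x _ hx => ⟨hl _ (Nat.zero_le _) ?_, ?_, ?_⟩, ?_⟩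
      · dsimp only
        omega
      · dsimp only
        omega
      · dsimp only
        omega
      · intro x _ y _ hx hy hxy
        dsimp only
        omega
    · have hlX : l ∉ X := fun hlX => hmin l (by omega) fun x h1 h2 => by
        rcases h1.eq_or_lt with rfl | h1
        · exact hlX
        · exact hl x h1 h2
      obtain ⟨φ, h1, h2⟩ := ih l (by omega)
      refine ⟨fun x => if l < x then l + N - x else φ x, fun x hxX hx => ?_, ?_⟩
      · dsimp only
        by_cases hlx : l < x
        · rw [if_pos hlx, if_pos (by omega)]
          exact ⟨hl _ (by omega) (by omega), by omega, by omega⟩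
        · have hne : x ≠ l := fun h => hlX (h ▸ hxX)
          obtain ⟨ha, hb, hc⟩ := h1 x hxX (by omega)
          rw [if_neg hlx, if_neg (by omega)]
          exact ⟨ha, by omega, hc⟩
      · intro x hxX y hyX hx hy hxy
        have hnex : x ≠ l := fun h => hlX (h ▸ hxX)
        have hney : y ≠ l := fun h => hlX (h ▸ hyX)
        dsimp only
        by_cases hlx : l < x
        · rw [if_pos hlx, if_pos (by omega)]
          omega
        · rw [if_neg hlx, if_neg (by omega)]
          exact h2 x hxX y hyX (by omega) (by omega) hxy

theorem consecNat_selfDual_ind (full : Bool) {X : Set ℕ} (hX : X.Finite) :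
    SelfDual ((consecNat full).ind X) := by
  obtain ⟨N, hN⟩ := hX.bddAbove
  obtain ⟨φ, h1, h2⟩ := exists_block_reversal X (N + 1)
  have hlt : ∀ x ∈ X, x < N + 1 := fun x hx => Nat.lt_succ_of_le (hN hx)
  have hinv : Function.Involutive
      (fun x : X => (⟨φ x, (h1 x x.2 (hlt x x.2)).1⟩ : X)) :=
    fun x => Subtype.ext (h1 x x.2 (hlt x x.2)).2.2
  refine ⟨hinv.toPerm, ?_⟩
  rintro ⟨x, hx⟩ ⟨y, hy⟩
  change (consecNat full).Arc x y ↔ (consecNat full).Arc (φ y) (φ x)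
  obtain ⟨hx1, hx2, hx3⟩ := h1 x hx (hlt x hx)
  obtain ⟨hy1, hy2, hy3⟩ := h1 y hy (hlt y hy)
  have hs : ∀ x ∈ X, ∀ y ∈ X, y = x + 1 ↔ φ x = φ y + 1 := by
    intro x hx y hy
    refine ⟨h2 x hx y hy (hlt x hx) (hlt y hy), fun he => ?_⟩
    obtain ⟨hx1, hx2, hx3⟩ := h1 x hx (hlt x hx)
    obtain ⟨hy1, hy2, hy3⟩ := h1 y hy (hlt y hy)
    have := h2 _ hy1 _ hx1 hy2 hx2 he
    rwa [hx3, hy3] at this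
  have e1 := hs x hx y hy
  have e2 := hs y hy x hx
  have e3 : x = y ↔ φ x = φ y :=
    ⟨fun h => by rw [h], fun h => by rw [← hx3, h, hy3]⟩
  simp only [consecNat, ofRel]
  rcases full with _ | _
  · simp only [Bool.false_eq_true, false_and, or_false]
    omega
  · simp only [true_and]
    omega

theorem OneEndInfiniteConsecutivity.selfDual_ind {V : Type*} {H : Dgraph V}
    (h : H.OneEndInfiniteConsecutivity) {X : Set V} (hX : X.Finite) : SelfDual (H.ind X) := by
  obtain ⟨full, ⟨e, he⟩ | ⟨e, he⟩⟩ := h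
  · exact (consecNat_selfDual_ind full (hX.image e)).of_iso
      (Iso.symm ⟨e.image X, fun x y => he x y⟩)
  · exact (consecNat_selfDual_ind full (hX.image e)).dual.of_iso
      (Iso.symm ⟨e.image X, fun x y => he x y⟩)

end Consec

end Dgraph

namespace Dgraph
section Sets

variable {V : Type*} {H : Dgraph V}

/-- A set without three distinct elements. -/
theorem subsingleton_or_pair_of_no_three [Nonempty V] {P : V → Prop}
    (hP : ¬ ∃ x y z, P x ∧ P y ∧ P z ∧ x ≠ y ∧ x ≠ z ∧ y ≠ z) :
    (∃ x, ∀ p, P p → p = x) ∨ ∃ x y, P x ∧ P y ∧ x ≠ y ∧ ∀ p, P p → p = x ∨ p = y := by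
  by_cases h2 : ∃ x y, P x ∧ P y ∧ x ≠ y
  · obtain ⟨x, y, hx, hy, hxy⟩ := h2
    refine Or.inr ⟨x, y, hx, hy, hxy, fun p hp => ?_⟩
    by_contra hc
    push Not at hc
    exact hP ⟨x, y, p, hx, hy, hp, hxy, hc.1.symm, hc.2.symm⟩
  · left
    push Not at h2
    by_cases h1 : ∃ x, P x
    · obtain ⟨x, hx⟩ := h1
      exact ⟨x, fun p hp => h2 p x hp hx⟩
    · push Not at h1
      exact ⟨Classical.arbitrary V, fun p hp => absurd hp (h1 p)⟩

/-- Directed pairs of distinct elements and no directed three-cycle. -/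
structure IsChainOn (H : Dgraph V) (P : V → Prop) : Prop where
  dir : ∀ x y, P x → P y → x ≠ y → H.Dir x y
  no_cycle : ∀ x y z, P x → P y → P z → H.To x y → H.To y z → ¬ H.To z x

theorem IsChainOn.trans {P : V → Prop} (h : H.IsChainOn P) {x y z : V} (hx : P x) (hy : P y)
    (hz : P z) (hxy : H.To x y) (hyz : H.To y z) : H.To x z := by
  have hne : x ≠ z := by
    rintro rfl
    exact hxy.2 hyz.1
  exact (h.dir x z hx hz hne).resolve_right (h.no_cycle x y z hx hy hz hxy hyz)

theorem IsChainOn.isChainD {P : V → Prop} (h : H.IsChainOn P) :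
    (H.ind {x | P x}).IsChainD := by
  have hto : ∀ x y, P x → P y → H.Arc x y → H.To x y := by
    intro x y hx hy hxy
    have hne : x ≠ y := by
      rintro rfl
      exact H.irrefl _ hxy
    exact (h.dir x y hx hy hne).resolve_right fun hd => hd.2 hxy
  refine ⟨fun x y hxy => h.dir x y x.2 y.2 fun he => hxy (Subtype.ext he), ?_⟩
  intro x y z hxy hyz
  exact (h.trans x.2 y.2 z.2 (hto x y x.2 y.2 hxy) (hto y z y.2 z.2 hyz)).1

theorem IsChainOn.exists_sorted {P : V → Prop} (h : H.IsChainOn P)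
    (h3 : ∃ x y z, P x ∧ P y ∧ P z ∧ x ≠ y ∧ x ≠ z ∧ y ≠ z) :
    ∃ x y z, P x ∧ P y ∧ P z ∧ H.To x y ∧ H.To y z ∧ H.To x z := by
  obtain ⟨x, y, z, hx, hy, hz, hxy, hxz, hyz⟩ := h3
  have key : ∃ x y z, P x ∧ P y ∧ P z ∧ H.To x y ∧ H.To y z := by
    rcases h.dir x y hx hy hxy with d1 | d1 <;> rcases h.dir y z hy hz hyz with d2 | d2 <;>
      rcases h.dir x z hx hz hxz with d3 | d3
    · exact ⟨x, y, z, hx, hy, hz, d1, d2⟩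
    · exact ⟨x, y, z, hx, hy, hz, d1, d2⟩
    · exact ⟨x, z, y, hx, hz, hy, d3, d2⟩
    · exact ⟨z, x, y, hz, hx, hy, d3, d1⟩
    · exact ⟨y, x, z, hy, hx, hz, d1, d3⟩
    · exact ⟨y, z, x, hy, hz, hx, d2, d3⟩
    · exact ⟨z, y, x, hz, hy, hx, d2, d1⟩
    · exact ⟨z, y, x, hz, hy, hx, d2, d1⟩
  obtain ⟨x, y, z, hx, hy, hz, d1, d2⟩ := key
  exact ⟨x, y, z, hx, hy, hz, d1, d2, h.trans hx hy hz d1 d2⟩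

theorem IsChainOn.exists_pair {P : V → Prop} (h : H.IsChainOn P) {x y : V} (hx : P x)
    (hy : P y) (hxy : x ≠ y) (hc : ∀ p, P p → p = x ∨ p = y) :
    ∃ x y, P x ∧ P y ∧ H.To x y ∧ ∀ p, P p → p = x ∨ p = y := by
  rcases h.dir x y hx hy hxy with d | d
  · exact ⟨x, y, hx, hy, d, hc⟩
  · exact ⟨y, x, hy, hx, d, fun p hp => (hc p hp).symm⟩

end Sets

section NeutralPair

variable {V : Type*} {H : Dgraph V}

/-- A neutral pair, of type `s`, capping a directed pair that lies on a common cycle. -/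
def capModel (s : Bool) : Fin 5 → Fin 5 → Bool :=
  ![![false, s, true, true, false], ![s, false, false, false, true],
    ![false, true, false, true, false], ![false, true, false, false, false],
    ![true, false, true, true, false]]

theorem capModel_not_selfDual (s : Bool) (σ : Equiv.Perm (Fin 5)) :
    ∃ i j, capModel s i j ≠ capModel s (σ j) (σ i) := by
  by_contra! hσ
  have key : ∀ s, ∀ x y, capModel s y x → ∀ z, capModel s x z → capModel s y z →
      ∀ a, capModel s x a → capModel s y a → capModel s a z →
      ∀ b, capModel s b x → capModel s b y → capModel s z b →
      (capModel s b a && capModel s a b) ≠ s := by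
    decide
  apply key s (σ 2) (σ 3) _ (σ 4) _ _ (σ 0) _ _ _ (σ 1) _ _ _ <;>
    simp only [← hσ] <;> cases s <;> rfl

theorem neutral_cap_model (h : SelfDualUpTo 5 H) {a b x y z : V} (hab : H.Neutral a b)
    (hax : H.To a x) (hxb : H.To x b) (hay : H.To a y) (hyb : H.To y b) (hxy : H.To x y)
    (hbz : H.To b z) (hza : H.To z a) (hzx : H.To z x) : ¬ H.To z y := by
  intro hzy
  have n1 := hab.1
  have n2 := hab.arc_comm
  have n3 := hax.ne
  have n4 := hay.ne
  have n5 := hza.ne.symm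
  have n6 := hxb.ne.symm
  have n7 := hyb.ne.symm
  have n8 := hbz.ne
  have n9 := hxy.ne
  have n10 := hzx.ne.symm
  have n11 := hzy.ne.symm
  simp only [To] at hax hxb hay hyb hxy hbz hza hzx hzy
  by_cases hc : H.Arc b a
  · refine h.no_model _ (capModel_not_selfDual true) ![a, b, x, y, z] ?_ ?_
    all_goals simp only [capModel, Fin.forall_fin_succ, Matrix.cons_val_zero, Matrix.cons_val_succ]
    all_goals simp [H.irrefl, *]
  · refine h.no_model _ (capModel_not_selfDual false) ![a, b, x, y, z] ?_ ?_
    all_goals simp only [capModel, Fin.forall_fin_succ, Matrix.cons_val_zero, Matrix.cons_val_succ]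
    all_goals simp [H.irrefl, *]

theorem neutral_cap_right (h : SelfDualUpTo 5 H) {a b x y z : V} (hab : H.Neutral a b)
    (hax : H.To a x) (hxb : H.To x b) (hay : H.To a y) (hyb : H.To y b) (hxy : H.To x y)
    (hbz : H.To b z) (hza : H.To z a) : ¬ H.To z y := by
  intro hzy
  have hxz : x ≠ z := by
    rintro rfl
    exact hax.2 hza.1
  rcases dir_of_to_to' (h.mono (by norm_num)) hxy hzy hxz with hd | hd
  · exact no_in_diamond (h.mono (by norm_num)) hay hxy hzy hax hd hza
  · exact neutral_cap_model h hab hax hxb hay hyb hxy hbz hza hd hzy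

theorem neutral_cap_left (h : SelfDualUpTo 5 H) {a b x y z : V} (hab : H.Neutral a b)
    (hax : H.To a x) (hxb : H.To x b) (hay : H.To a y) (hyb : H.To y b) (hxy : H.To x y)
    (hbz : H.To b z) (hza : H.To z a) : ¬ H.To x z := fun hxz =>
  neutral_cap_right h.dual (dual_neutral.2 hab.symm) (dual_to.2 hyb) (dual_to.2 hay)
    (dual_to.2 hxb) (dual_to.2 hax) (dual_to.2 hxy) (dual_to.2 hza) (dual_to.2 hbz)
    (dual_to.2 hxz)

/-- The vertices from `a` to `b`. -/
def Between (H : Dgraph V) (a b : V) (p : V) : Prop := H.To a p ∧ H.To p b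

theorem between_or_between (h : SelfDualUpTo 3 H)
    (hN : ∀ x y z, H.Neutral x y → H.Neutral x z → y = z) {a b : V} (hab : H.Neutral a b)
    {c : V} (ha : c ≠ a) (hb : c ≠ b) : H.Between a b c ∨ H.Between b a c := by
  have h1 : H.Dir a c := by
    rcases eq_or_dir_or_neutral H a c with he | hd | hn
    · exact absurd he.symm ha
    · exact hd
    · exact absurd (hN _ _ _ hn hab) hb
  have h2 : H.Dir b c := by
    rcases eq_or_dir_or_neutral H b c with he | hd | hn
    · exact absurd he.symm hb
    · exact hd
    · exact absurd (hN _ _ _ hn hab.symm) ha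
  rcases h1 with h1 | h1 <;> rcases h2 with h2 | h2
  · exact absurd (dir_of_to_to' h h1 h2 hab.1) hab.2
  · exact Or.inl ⟨h1, h2⟩
  · exact Or.inr ⟨h2, h1⟩
  · exact absurd (dir_of_to_to h h1 h2 hab.1) hab.2

theorem between_isChainOn (h : SelfDualUpTo 4 H) (a b : V) : H.IsChainOn (H.Between a b) :=
  ⟨fun _ _ hx hy hxy => dir_of_to_to (h.mono (by norm_num)) hx.1 hy.1 hxy,
    fun _ _ _ hx hy hz hxy hyz => no_out_diamond h hx.1 hy.1 hz.1 hxy hyz⟩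

theorem between_empty_of_three (h : SelfDualUpTo 5 H)
    (hN : ∀ x y z, H.Neutral x y → H.Neutral x z → y = z) {a b : V} (hab : H.Neutral a b)
    (h3 : ∃ x y z, H.Between a b x ∧ H.Between a b y ∧ H.Between a b z ∧
      x ≠ y ∧ x ≠ z ∧ y ≠ z) (q : V) : ¬ H.Between b a q := by
  rintro ⟨hbq, hqa⟩
  obtain ⟨x, y, z, ⟨hax, hxb⟩, ⟨hay, hyb⟩, ⟨haz, hzb⟩, hxy, hyz, hxz⟩ :=
    (between_isChainOn (h.mono (by norm_num)) a b).exists_sorted h3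
  have hne : ∀ p, H.To a p → p ≠ q := by
    rintro p hp rfl
    exact hp.2 hqa.1
  have hyq : H.Neutral y q := by
    refine ⟨hne y hay, ?_⟩
    rintro (hd | hd)
    · exact neutral_cap_left h hab hay hyb haz hzb hyz hbq hqa hd
    · exact neutral_cap_right h hab hax hxb hay hyb hxy hbq hqa hd
  have hzq : H.To z q := by
    rcases eq_or_dir_or_neutral H z q with he | (hd | hd) | hn
    · exact absurd he (hne z haz)
    · exact hd
    · exact absurd hd (neutral_cap_right h hab hay hyb haz hzb hyz hbq hqa)
    · exact absurd (hN _ _ _ hn.symm hyq.symm) hyz.ne.symm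
  have hqx : H.To q x := by
    rcases eq_or_dir_or_neutral H x q with he | (hd | hd) | hn
    · exact absurd he (hne x hax)
    · exact absurd hd (neutral_cap_left h hab hax hxb hay hyb hxy hbq hqa)
    · exact hd
    · exact absurd (hN _ _ _ hn.symm hyq.symm) hxy.ne
  exact neutral_cap_right h hyq hyz hzq hyb hbq hzb hqx hxy hxb

/-- Six vertices in circular order, antipodal pairs being neutral of prescribed types. -/
def antipodal (α β γ : Bool) (i j : Fin 6) : Bool :=
  if j = i + 1 ∨ j = i + 2 then true
  else if j = i + 3 then ![α, β, γ, α, β, γ] i else false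

theorem antipodal_selfDual (α β γ : Bool) : ∃ σ : Equiv.Perm (Fin 6),
    ∀ i j, antipodal α β γ i j = antipodal α β γ (σ j) (σ i) := by
  by_cases h1 : α = β
  · exact ⟨Equiv.subLeft 1, by subst h1; revert α γ; decide⟩
  by_cases h2 : α = γ
  · exact ⟨Equiv.subLeft 2, by subst h2; revert α β; decide⟩
  have h3 : β = γ := by
    revert h1 h2
    revert α β γ
    decide
  exact ⟨Equiv.subLeft 0, by subst h3; clear h1 h2; revert α β; decide⟩

theorem selfDual_of_neutral (h : SelfDualUpTo 5 H)
    (hN : ∀ x y z, H.Neutral x y → H.Neutral x z → y = z)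
    (hI : H.NoInfiniteChainInterval) {a b : V} (hab : H.Neutral a b) : SelfDual H := by
  classical
  have h4 : SelfDualUpTo 4 H := h.mono (by norm_num)
  have hcov := fun c => between_or_between (c := c) (h.mono (by norm_num)) hN hab
  have hcap : ∀ {a b : V}, H.Neutral a b → (∀ q, ¬ H.Between b a q) → SelfDual H := by
    intro a b hab hq
    refine hI.selfDual_of_caps hab.1 {p | H.Between a b p} (fun p => ⟨fun hp => ?_, fun hp => ?_⟩)
      (fun p hp => hp.1) (fun p hp => hp.2) (between_isChainOn h4 a b).isChainD
    · exact ⟨hp.1.ne.symm, hp.2.ne⟩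
    · exact (between_or_between (h.mono (by norm_num)) hN hab hp.1 hp.2).resolve_right (hq p)
  have : Nonempty V := ⟨a⟩
  by_cases hP : ∃ x y z, H.Between a b x ∧ H.Between a b y ∧ H.Between a b z ∧
      x ≠ y ∧ x ≠ z ∧ y ≠ z
  · exact hcap hab (between_empty_of_three h hN hab hP)
  by_cases hQ : ∃ x y z, H.Between b a x ∧ H.Between b a y ∧ H.Between b a z ∧
      x ≠ y ∧ x ≠ z ∧ y ≠ z
  · exact hcap hab.symm (between_empty_of_three h hN hab.symm hQ)
  have hfive : ∀ x z w, (∀ c, c ≠ a → c ≠ b → c = x ∨ c = z ∨ c = w) → SelfDual H := by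
    intro x z w hc
    refine h.of_surjective ![a, b, x, z, w] fun c => ?_
    by_cases hca : c = a
    · exact ⟨0, hca.symm⟩
    by_cases hcb : c = b
    · exact ⟨1, hcb.symm⟩
    rcases hc c hca hcb with rfl | rfl | rfl
    · exact ⟨2, rfl⟩
    · exact ⟨3, rfl⟩
    · exact ⟨4, rfl⟩
  rcases subsingleton_or_pair_of_no_three hP with ⟨x, hx⟩ | ⟨x, y, hx, hy, hxy, hxyc⟩ <;>
    rcases subsingleton_or_pair_of_no_three hQ with ⟨z, hz⟩ | ⟨z, w, hz, hw, hzw, hzwc⟩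
  · exact hfive x z z fun c hca hcb => by
      rcases hcov c hca hcb with hc | hc
      · exact Or.inl (hx c hc)
      · exact Or.inr (Or.inl (hz c hc))
  · exact hfive x z w fun c hca hcb => by
      rcases hcov c hca hcb with hc | hc
      · exact Or.inl (hx c hc)
      · exact Or.inr (hzwc c hc)
  · exact hfive z x y fun c hca hcb => by
      rcases hcov c hca hcb with hc | hc
      · exact Or.inr (hxyc c hc)
      · exact Or.inl (hz c hc)
  · obtain ⟨x, y, ⟨hax, hxb⟩, ⟨hay, hyb⟩, txy, hxyc⟩ :=
      (between_isChainOn h4 a b).exists_pair hx hy hxy hxyc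
    obtain ⟨z, w, ⟨hbz, hza⟩, ⟨hbw, hwa⟩, tzw, hzwc⟩ :=
      (between_isChainOn h4 b a).exists_pair hz hw hzw hzwc
    have hne : ∀ p q, H.To a p → H.To q a → p ≠ q := by
      rintro p q hp hq rfl
      exact hp.2 hq.1
    have nxz : H.Neutral x z := by
      refine ⟨hne x z hax hza, ?_⟩
      rintro (hd | hd)
      · exact neutral_cap_left h hab hax hxb hay hyb txy hbz hza hd
      · exact neutral_cap_left h hab.symm hbz hza hbw hwa tzw hax hxb hd
    have nyw : H.Neutral y w := by
      refine ⟨hne y w hay hwa, ?_⟩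
      rintro (hd | hd)
      · exact neutral_cap_right h hab.symm hbz hza hbw hwa tzw hay hyb hd
      · exact neutral_cap_right h hab hax hxb hay hyb txy hbw hwa hd
    have tyz : H.To y z := by
      rcases eq_or_dir_or_neutral H y z with he | (hd | hd) | hn
      · exact absurd he (hne y z hay hza)
      · exact hd
      · exact absurd hd (neutral_cap_right h hab hax hxb hay hyb txy hbz hza)
      · exact absurd (hN _ _ _ hn nyw) tzw.ne
    have twx : H.To w x := by
      rcases eq_or_dir_or_neutral H x w with he | (hd | hd) | hn
      · exact absurd he (hne x w hax hwa)
      · exact absurd hd (neutral_cap_left h hab hax hxb hay hyb txy hbw hwa)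
      · exact hd
      · exact absurd (hN _ _ _ hn nxz).symm tzw.ne
    obtain ⟨σ, hσ⟩ := antipodal_selfDual (decide (H.Arc a b)) (decide (H.Arc x z))
      (decide (H.Arc y w))
    have n1 := hab.arc_comm.symm
    have n2 := nxz.arc_comm.symm
    have n3 := nyw.arc_comm.symm
    have m1 := hab.1
    have m2 := nxz.1
    have m3 := nyw.1
    have e1 := hax.ne
    have e2 := hay.ne
    have e3 := hza.ne.symm
    have e4 := hwa.ne.symm
    have e5 := hxb.ne
    have e6 := hyb.ne
    have e7 := hbz.ne
    have e8 := hbw.ne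
    have e9 := txy.ne
    have e10 := tzw.ne
    have e11 := tyz.ne
    have e12 := twx.ne.symm
    simp only [To] at hax hxb hay hyb txy hbz hza hbw hwa tzw tyz twx
    have hM : ∀ i j, H.Arc (![a, x, y, b, z, w] i) (![a, x, y, b, z, w] j) ↔
        antipodal (decide (H.Arc a b)) (decide (H.Arc x z)) (decide (H.Arc y w)) i j = true := by
      simp only [antipodal]
      simp only [Fin.forall_fin_succ, Matrix.cons_val_zero, Matrix.cons_val_succ]
      simp [H.irrefl, *]
    refine selfDual_of_param ![a, x, y, b, z, w] ⟨?_, fun c => ?_⟩ σ fun i j => ?_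
    · have hlt : ∀ i j : Fin 6, i < j → ![a, x, y, b, z, w] i ≠ ![a, x, y, b, z, w] j := by
        simp only [Fin.forall_fin_succ, Matrix.cons_val_zero, Matrix.cons_val_succ]
        simp [*]
      intro i j hij
      rcases lt_trichotomy i j with hd | hd | hd
      · exact absurd hij (hlt i j hd)
      · exact hd
      · exact absurd hij.symm (hlt j i hd)
    · by_cases hca : c = a
      · exact ⟨0, hca.symm⟩
      by_cases hcb : c = b
      · exact ⟨3, hcb.symm⟩
      rcases hcov c hca hcb with hc | hc
      · rcases hxyc c hc with rfl | rfl
        · exact ⟨1, rfl⟩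
        · exact ⟨2, rfl⟩
      · rcases hzwc c hc with rfl | rfl
        · exact ⟨4, rfl⟩
        · exact ⟨5, rfl⟩
    · rw [hM, hM, hσ]

end NeutralPair
end Dgraph

namespace Dgraph
section Tournament

variable {V : Type*} {H : Dgraph V}

/-- The three-cycle with its vertices blown up to chains on three, two and one vertices. -/
def blowupModel : Fin 6 → Fin 6 → Bool :=
  ![![false, true, true, true, true, false],
    ![false, false, true, true, true, false], ![false, false, false, true, true, false],
    ![false, false, false, false, true, true], ![false, false, false, false, false, true],
    ![true, true, true, false, false, false]]

theorem blowupModel_not_selfDual (σ : Equiv.Perm (Fin 6)) :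
    ∃ i j, blowupModel i j ≠ blowupModel (σ j) (σ i) := by
  by_contra! hσ
  have key : ∀ a b, blowupModel b a → ∀ c, blowupModel c a → blowupModel c b →
      ∀ d, blowupModel d a → blowupModel d b → blowupModel d c →
      ∀ e, blowupModel e a → blowupModel e b → blowupModel e c → blowupModel e d →
      ∀ f, blowupModel a f → blowupModel b f → blowupModel c f → blowupModel f d →
      ¬ blowupModel f e := by
    decide
  apply key (σ 0) (σ 1) _ (σ 2) _ _ (σ 3) _ _ _ (σ 4) _ _ _ _ (σ 5) <;> rw [← hσ] <;> rfl

theorem sorted_blowup_model (h : SelfDualUpTo 6 H) {p₁ p₂ p₃ q₁ q₂ r : V} (h12 : H.To p₁ p₂)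
    (h23 : H.To p₂ p₃) (h13 : H.To p₁ p₃) (hq : H.To q₁ q₂) (h11 : H.To p₁ q₁)
    (h21 : H.To p₂ q₁) (h31 : H.To p₃ q₁) (h12' : H.To p₁ q₂) (h22 : H.To p₂ q₂)
    (h32 : H.To p₃ q₂) (hr1 : H.To r p₁) (hr2 : H.To r p₂) (hr3 : H.To r p₃)
    (hq1 : H.To q₁ r) (hq2 : H.To q₂ r) : False := by
  have n1 := h12.ne
  have n2 := h23.ne
  have n3 := h13.ne
  have n4 := hq.ne
  have n5 := h11.ne
  have n6 := h21.ne
  have n7 := h31.ne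
  have n8 := h12'.ne
  have n9 := h22.ne
  have n10 := h32.ne
  have n11 := hr1.ne.symm
  have n12 := hr2.ne.symm
  have n13 := hr3.ne.symm
  have n14 := hq1.ne
  have n15 := hq2.ne
  simp only [To] at h12 h23 h13 hq h11 h21 h31 h12' h22 h32 hr1 hr2 hr3 hq1 hq2
  refine h.no_model _ blowupModel_not_selfDual ![p₁, p₂, p₃, q₁, q₂, r] ?_ ?_
  all_goals simp only [blowupModel, Fin.forall_fin_succ, Matrix.cons_val_zero, Matrix.cons_val_succ]
  all_goals simp [H.irrefl, *]

theorem no_blowup (hT : ∀ x y, x ≠ y → H.Dir x y) (h : SelfDualUpTo 6 H) {P : Set V}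
    {q q' r : V} (hP : ∃ x y z, x ∈ P ∧ y ∈ P ∧ z ∈ P ∧ x ≠ y ∧ x ≠ z ∧ y ≠ z) (hq : q ≠ q')
    (hPq : ∀ p ∈ P, H.To p q) (hPq' : ∀ p ∈ P, H.To p q') (hqr : H.To q r) (hq'r : H.To q' r)
    (hr : ∀ p ∈ P, H.To r p) : False := by
  have hc : H.IsChainOn (· ∈ P) := ⟨fun x y _ _ => hT x y, fun x y z hx hy hz hxy hyz =>
    no_in_diamond (h.mono (by norm_num)) (hPq x hx) (hPq y hy) (hPq z hz) hxy hyz⟩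
  obtain ⟨x, y, z, hx, hy, hz, hxy, hyz, hxz⟩ := hc.exists_sorted hP
  rcases hT q q' hq with hd | hd
  · exact sorted_blowup_model h hxy hyz hxz hd (hPq x hx) (hPq y hy) (hPq z hz) (hPq' x hx)
      (hPq' y hy) (hPq' z hz) (hr x hx) (hr y hy) (hr z hz) hqr hq'r
  · exact sorted_blowup_model h hxy hyz hxz hd (hPq' x hx) (hPq' y hy) (hPq' z hz) (hPq x hx)
      (hPq y hy) (hPq z hz) (hr x hx) (hr y hy) (hr z hz) hq'r hqr

theorem no_blowup' (hT : ∀ x y, x ≠ y → H.Dir x y) (h : SelfDualUpTo 6 H) {P : Set V}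
    {q q' r : V} (hP : ∃ x y z, x ∈ P ∧ y ∈ P ∧ z ∈ P ∧ x ≠ y ∧ x ≠ z ∧ y ≠ z) (hq : q ≠ q')
    (hPq : ∀ p ∈ P, H.To q p) (hPq' : ∀ p ∈ P, H.To q' p) (hqr : H.To r q) (hq'r : H.To r q')
    (hr : ∀ p ∈ P, H.To p r) : False :=
  no_blowup (H := H.dual) (fun x y hxy => dual_dir.2 (hT x y hxy)) h.dual hP hq hPq hPq' hqr
    hq'r hr

/-- The regular tournament on five vertices. -/
def IsFive (H : Dgraph V) (t : Fin 5 → V) : Prop :=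
  ∀ i, H.To (t i) (t (i + 1)) ∧ H.To (t i) (t (i + 2))

/-- `v` is related as `t i` is to the four other vertices. -/
def IsTwin (H : Dgraph V) (t : Fin 5 → V) (i : Fin 5) (v : V) : Prop :=
  H.To v (t (i + 1)) ∧ H.To v (t (i + 2)) ∧ H.To (t (i + 3)) v ∧ H.To (t (i + 4)) v

theorem five_sets (S : Fin 5 → Bool) (h1 : ∀ i, ¬ (S i = true ∧ S (i + 1) = true ∧
    S (i + 3) = true)) (h2 : ∀ i, ¬ (S i = false ∧ S (i + 1) = false ∧ S (i + 3) = false)) :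
    ∃ i, S (i + 1) = true ∧ S (i + 2) = true ∧ S (i + 3) = false ∧ S (i + 4) = false := by
  revert S
  decide

theorem IsFive.exists_twin (hT : ∀ x y, x ≠ y → H.Dir x y) (h : SelfDualUpTo 4 H)
    {t : Fin 5 → V} (ht : H.IsFive t) {v : V} (hv : ∀ i, v ≠ t i) : ∃ i, H.IsTwin t i v := by
  classical
  have hcyc : ∀ i, H.To (t (i + 1)) (t (i + 3)) ∧ H.To (t (i + 3)) (t i) := by
    intro i
    have h1 := (ht (i + 1)).2
    have h2 := (ht (i + 3)).2
    rw [add_assoc] at h1 h2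
    rw [show i + (3 + 2) = i from add_zero i] at h2
    exact ⟨h1, h2⟩
  have hS : ∀ i, decide (H.To v (t i)) = true ↔ H.To v (t i) := fun i => decide_eq_true_iff
  have hS' : ∀ i, decide (H.To v (t i)) = false ↔ H.To (t i) v := fun i => by
    rw [decide_eq_false_iff_not]
    exact ⟨fun hn => (hT v (t i) (hv i)).resolve_left hn, fun hn hn' => hn.2 hn'.1⟩
  obtain ⟨i, h1, h2, h3, h4⟩ := five_sets (fun i => decide (H.To v (t i)))
    (fun i hi => by
      simp only [hS] at hi
      exact no_out_diamond h hi.1 hi.2.1 hi.2.2 (ht i).1 (hcyc i).1 (hcyc i).2)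
    (fun i hi => by
      simp only [hS'] at hi
      exact no_in_diamond h hi.1 hi.2.1 hi.2.2 (ht i).1 (hcyc i).1 (hcyc i).2)
  exact ⟨i, (hS _).1 h1, (hS _).1 h2, (hS' _).1 h3, (hS' _).1 h4⟩

theorem IsFive.two_twins_zero (hT : ∀ x y, x ≠ y → H.Dir x y) (h : SelfDualUpTo 6 H)
    {t : Fin 5 → V} (ht : H.IsFive t) {v w : V} (hv : ∀ i, v ≠ t i) (hw : ∀ i, w ≠ t i)
    (hvw : v ≠ w) {d : Fin 5} (hd : d = 0 ∨ d = 1 ∨ d = 2) (hv0 : H.IsTwin t 0 v)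
    (hwd : H.IsTwin t d w) : d = 2 ∧ H.To v (t 0) ∧ H.To (t 2) w ∧ H.To w v := by
  have h4 : SelfDualUpTo 4 H := h.mono (by norm_num)
  have a01 : H.To (t 0) (t 1) := (ht 0).1
  have a02 : H.To (t 0) (t 2) := (ht 0).2
  have a12 : H.To (t 1) (t 2) := (ht 1).1
  have a13 : H.To (t 1) (t 3) := (ht 1).2
  have a23 : H.To (t 2) (t 3) := (ht 2).1
  have a30 : H.To (t 3) (t 0) := (ht 3).2
  have v1 : H.To v (t 1) := hv0.1
  have v2 : H.To v (t 2) := hv0.2.1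
  have v3 : H.To (t 3) v := hv0.2.2.1
  have blow : H.To (t 0) w → H.To v w → H.To w (t 3) → False := fun b1 b2 b3 => by
    refine no_blowup' hT h (P := {t 1, t 2, w}) (q := t 0) (q' := v) (r := t 3)
      ⟨t 1, t 2, w, by simp, by simp, by simp, a12.ne, (hw 1).symm, (hw 2).symm⟩
      (hv 0).symm ?_ ?_ a30 v3 ?_
    all_goals simp [*]
  rcases hd with rfl | rfl | rfl
  · have w1 : H.To w (t 1) := hwd.1
    have w2 : H.To w (t 2) := hwd.2.1
    have w3 : H.To (t 3) w := hwd.2.2.1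
    exfalso
    refine no_blowup hT h (P := {t 0, v, w}) (q := t 1) (q' := t 2) (r := t 3)
      ⟨t 0, v, w, by simp, by simp, by simp, (hv 0).symm, (hw 0).symm, hvw⟩ a12.ne
      ?_ ?_ a13 a23 ?_
    all_goals simp [*]
  · have w2 : H.To w (t 2) := hwd.1
    have w3 : H.To w (t 3) := hwd.2.1
    have w0 : H.To (t 0) w := hwd.2.2.2
    exfalso
    rcases hT v w hvw with hd | hd
    · exact blow w0 hd w3
    · rcases hT v (t 0) (hv 0) with hd' | hd'
      · exact no_in_diamond h4 w2 v2 a02 hd hd' w0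
      · exact no_in_diamond h4 hd v3 hd' w3 a30 w0
  · have w3 : H.To w (t 3) := hwd.1
    have w0 : H.To (t 0) w := hwd.2.2.1
    have w1 : H.To (t 1) w := hwd.2.2.2
    rcases hT v w hvw with hd | hd
    · exact (blow w0 hd w3).elim
    rcases hT v (t 0) (hv 0) with hd' | hd'
    · rcases hT w (t 2) (hw 2) with hd2 | hd2
      · exact (no_in_diamond h4 hd2 v2 a02 hd hd' w0).elim
      · exact ⟨rfl, hd', hd2, hd⟩
    · exact (no_out_diamond h4 a01 w0 hd' w1 hd v1).elim

theorem IsFive.rotate {t : Fin 5 → V} (ht : H.IsFive t) (i : Fin 5) :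
    H.IsFive (fun k => t (i + k)) := by
  intro k
  have := ht (i + k)
  rwa [add_assoc, add_assoc] at this

theorem isTwin_rotate {t : Fin 5 → V} {i d : Fin 5} {v : V} :
    H.IsTwin (fun k => t (i + k)) d v ↔ H.IsTwin t (i + d) v := by
  simp only [IsTwin, add_assoc]

theorem IsFive.two_twins (hT : ∀ x y, x ≠ y → H.Dir x y) (h : SelfDualUpTo 6 H)
    {t : Fin 5 → V} (ht : H.IsFive t) {v w : V} (hv : ∀ i, v ≠ t i) (hw : ∀ i, w ≠ t i)
    (hvw : v ≠ w) {i j : Fin 5} (hvi : H.IsTwin t i v) (hwj : H.IsTwin t j w) :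
    (j = i + 2 ∧ H.To v (t i) ∧ H.To (t j) w ∧ H.To w v) ∨
      (i = j + 2 ∧ H.To w (t j) ∧ H.To (t i) v ∧ H.To v w) := by
  have key : ∀ {v w : V} {i d : Fin 5}, (∀ i, v ≠ t i) → (∀ i, w ≠ t i) → v ≠ w →
      (d = 0 ∨ d = 1 ∨ d = 2) → H.IsTwin t i v → H.IsTwin t (i + d) w →
      d = 2 ∧ H.To v (t i) ∧ H.To (t (i + 2)) w ∧ H.To w v := by
    intro v w i d hv hw hvw hd hvi hwj
    have := (ht.rotate i).two_twins_zero hT h (fun k => hv _) (fun k => hw _) hvw hd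
      (isTwin_rotate.2 (by rwa [add_zero])) (isTwin_rotate.2 hwj)
    simpa only [add_zero] using this
  have hij : (∃ d, (d = 0 ∨ d = 1 ∨ d = 2) ∧ j = i + d) ∨
      (∃ d, (d = 0 ∨ d = 1 ∨ d = 2) ∧ i = j + d) := by
    clear hvi hwj
    revert i j
    decide
  rcases hij with ⟨d, hd, rfl⟩ | ⟨d, hd, rfl⟩
  · obtain ⟨rfl, h1, h2, h3⟩ := key hv hw hvw hd hvi hwj
    exact Or.inl ⟨rfl, h1, h2, h3⟩
  · obtain ⟨rfl, h1, h2, h3⟩ := key hw hv hvw.symm hd hwj hvi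
    exact Or.inr ⟨rfl, h1, h2, h3⟩

theorem selfDual_of_seven (f : Fin 7 → V) (hf : Function.Surjective f)
    (hto : ∀ i, H.To (f i) (f (i + 1)) ∧ H.To (f i) (f (i + 2)) ∧ H.To (f i) (f (i + 3))) :
    SelfDual H := by
  have hcase : ∀ i j : Fin 7, i = j ∨ (j = i + 1 ∨ j = i + 2 ∨ j = i + 3) ∨
      (i = j + 1 ∨ i = j + 2 ∨ i = j + 3) := by decide
  have hTo : ∀ i j : Fin 7, (j = i + 1 ∨ j = i + 2 ∨ j = i + 3) → H.To (f i) (f j) := by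
    rintro i j (rfl | rfl | rfl)
    · exact (hto i).1
    · exact (hto i).2.1
    · exact (hto i).2.2
  refine selfDual_of_param f ⟨fun i j hij => ?_, hf⟩ (Equiv.neg _) fun i j => ?_
  · rcases hcase i j with hd | hd | hd
    · exact hd
    · exact absurd hij (hTo i j hd).ne
    · exact absurd hij.symm (hTo j i hd).ne
  · have hneg : ∀ i j : Fin 7, (j = i + 1 ∨ j = i + 2 ∨ j = i + 3) →
        (-i = -j + 1 ∨ -i = -j + 2 ∨ -i = -j + 3) := by decide
    rcases hcase i j with rfl | hd | hd
    · exact iff_of_false (H.irrefl _) (H.irrefl _)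
    · exact iff_of_true (hTo i j hd).1 (hTo _ _ (hneg i j hd)).1
    · exact iff_of_false (hTo j i hd).2 (hTo _ _ (hneg j i hd)).2

theorem IsFive.selfDual (hT : ∀ x y, x ≠ y → H.Dir x y) (h : SelfDualUpTo 6 H)
    {t : Fin 5 → V} (ht : H.IsFive t) : SelfDual H := by
  by_cases h2 : ∃ v w, (∀ i, v ≠ t i) ∧ (∀ i, w ≠ t i) ∧ v ≠ w
  · obtain ⟨v, w, hv, hw, hvw⟩ := h2
    have htw := fun {v : V} (hv : ∀ i, v ≠ t i) => ht.exists_twin hT (h.mono (by norm_num)) hv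
    have h3 : ∀ c, c = v ∨ c = w ∨ ∃ i, c = t i := by
      intro c
      by_contra hc
      push Not at hc
      obtain ⟨hcv, hcw, hc⟩ := hc
      obtain ⟨i, hi⟩ := htw hv
      obtain ⟨j, hj⟩ := htw hw
      obtain ⟨k, hk⟩ := htw hc
      rcases ht.two_twins hT h hv hw hvw hi hj with ⟨-, a1, a2, -⟩ | ⟨-, a1, a2, -⟩ <;>
        rcases ht.two_twins hT h hv hc hcv.symm hi hk with ⟨-, b1, b2, -⟩ | ⟨-, b1, b2, -⟩ <;>
        rcases ht.two_twins hT h hw hc hcw.symm hj hk with ⟨-, c1, c2, -⟩ | ⟨-, c1, c2, -⟩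
      · exact a2.2 c1.1
      · exact b2.2 c1.1
      · exact a1.2 b2.1
      · exact a1.2 b2.1
      · exact a2.2 b1.1
      · exact a2.2 b1.1
      · exact b1.2 c2.1
      · exact a1.2 c2.1
    have key : ∀ {v w : V}, (∀ c, c = v ∨ c = w ∨ ∃ i, c = t i) → ∀ i, H.IsTwin t i v →
        H.IsTwin t (i + 2) w → H.To v (t i) → H.To (t (i + 2)) w → H.To w v → SelfDual H := by
      intro v w h3 i hi hj e1 e2 e3
      obtain ⟨v1, v2, v3, v4⟩ := hi
      obtain ⟨w1, w2, w3, w4⟩ := hj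
      have s0 := ht i
      have s1 := ht (i + 1)
      have s2 := ht (i + 2)
      have s3 := ht (i + 3)
      have s4 := ht (i + 4)
      rw [add_assoc] at w1 w2 w3 w4
      rw [add_assoc, add_assoc] at s1 s2 s3 s4
      rw [show i + (3 + 2) = i from add_zero i] at s3
      rw [show i + (4 + 1) = i from add_zero i] at s4
      refine selfDual_of_seven ![t i, t (i + 1), t (i + 2), w, t (i + 3), t (i + 4), v]
        (fun c => ?_) ?_
      · rcases h3 c with rfl | rfl | ⟨j, rfl⟩
        · exact ⟨6, rfl⟩
        · exact ⟨3, rfl⟩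
        · have hj : j = i ∨ j = i + 1 ∨ j = i + 2 ∨ j = i + 3 ∨ j = i + 4 := by
            clear * -
            revert i j
            decide
          rcases hj with rfl | rfl | rfl | rfl | rfl
          · exact ⟨0, rfl⟩
          · exact ⟨1, rfl⟩
          · exact ⟨2, rfl⟩
          · exact ⟨4, rfl⟩
          · exact ⟨5, rfl⟩
      · rw [show i + (2 + 3) = i from add_zero i] at w3
        intro k
        fin_cases k
        · exact ⟨s0.1, s0.2, w3⟩
        · exact ⟨s1.1, w4, s1.2⟩
        · exact ⟨e2, s2.1, s2.2⟩
        · exact ⟨w1, w2, e3⟩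
        · exact ⟨s3.1, v3, s3.2⟩
        · exact ⟨v4, s4.1, s4.2⟩
        · exact ⟨e1, v1, v2⟩
    obtain ⟨i, hi⟩ := htw hv
    obtain ⟨j, hj⟩ := htw hw
    rcases ht.two_twins hT h hv hw hvw hi hj with ⟨rfl, a1, a2, a3⟩ | ⟨rfl, a1, a2, a3⟩
    · exact key h3 i hi hj a1 a2 a3
    · refine key (fun c => ?_) j hj hi a1 a2 a3
      have := h3 c
      tauto
  · have h1 : ∃ v, ∀ c, c = v ∨ ∃ i, c = t i := by
      by_cases h1 : ∃ v, ∀ i, v ≠ t i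
      · obtain ⟨v, hv⟩ := h1
        refine ⟨v, fun c => ?_⟩
        by_contra hc
        push Not at hc
        exact h2 ⟨c, v, hc.2, hv, hc.1⟩
      · push Not at h1
        exact ⟨t 0, fun c => Or.inr (h1 c)⟩
    obtain ⟨v, hv⟩ := h1
    refine h.of_surjective (Fin.cons v t) fun c => ?_
    rcases hv c with rfl | ⟨i, rfl⟩
    · exact ⟨0, rfl⟩
    · exact ⟨i.succ, rfl⟩

/-- The vertices related to `y` and `z` as the third vertex of a cycle is. -/
def CycleClass (H : Dgraph V) (y z : V) : Set V := {v | H.To z v ∧ H.To v y}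

theorem cycleClass_to (hT : ∀ x y, x ≠ y → H.Dir x y) (h : SelfDualUpTo 4 H)
    (h5 : ∀ t, ¬ H.IsFive t) {x y z : V} (hxy : H.To x y) (hyz : H.To y z) (hzx : H.To z x)
    {v u : V} (hv : v ∈ H.CycleClass y z) (hu : u ∈ H.CycleClass z x) : H.To v u := by
  obtain ⟨hzv, hvy⟩ := hv
  obtain ⟨hxu, huz⟩ := hu
  by_contra hvu
  have hne : v ≠ u := by
    rintro rfl
    exact hzv.2 huz.1
  have huv := (hT v u hne).resolve_left hvu
  have hvx : v ≠ x := by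
    rintro rfl
    exact hvu hxu
  have huy : u ≠ y := by
    rintro rfl
    exact hvu hvy
  rcases hT v x hvx with d1 | d1 <;> rcases hT u y huy with d2 | d2
  · exact no_out_diamond h huv d2 huz hvy hyz hzv
  · refine h5 ![x, y, u, z, v] fun i => ?_
    fin_cases i
    · exact ⟨hxy, hxu⟩
    · exact ⟨d2, hyz⟩
    · exact ⟨huz, huv⟩
    · exact ⟨hzv, hzx⟩
    · exact ⟨d1, hvy⟩
  · exact no_in_diamond h hzv d1 huv hzx hxu huz
  · exact no_out_diamond h hxu d1 hxy huv hvy d2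

theorem cycleClass_cover (hT : ∀ x y, x ≠ y → H.Dir x y) (h : SelfDualUpTo 4 H) {x y z : V}
    (hxy : H.To x y) (hyz : H.To y z) (hzx : H.To z x) (v : V) :
    v ∈ H.CycleClass y z ∨ v ∈ H.CycleClass z x ∨ v ∈ H.CycleClass x y := by
  by_cases h1 : v = x
  · exact Or.inl (h1 ▸ ⟨hzx, hxy⟩)
  by_cases h2 : v = y
  · exact Or.inr (Or.inl (h2 ▸ ⟨hxy, hyz⟩))
  by_cases h3 : v = z
  · exact Or.inr (Or.inr (h3 ▸ ⟨hyz, hzx⟩))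
  rcases hT v x h1 with d1 | d1 <;> rcases hT v y h2 with d2 | d2 <;>
    rcases hT v z h3 with d3 | d3
  · exact absurd hzx (no_out_diamond h d1 d2 d3 hxy hyz)
  · exact Or.inl ⟨d3, d2⟩
  · exact Or.inr (Or.inr ⟨d2, d1⟩)
  · exact Or.inr (Or.inr ⟨d2, d1⟩)
  · exact Or.inr (Or.inl ⟨d1, d3⟩)
  · exact Or.inl ⟨d3, d2⟩
  · exact Or.inr (Or.inl ⟨d1, d3⟩)
  · exact absurd hzx (no_in_diamond h d1 d2 d3 hxy hyz)

theorem selfDual_of_large_cycleClass (hT : ∀ x y, x ≠ y → H.Dir x y) (h : SelfDualUpTo 6 H)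
    (hI : H.NoInfiniteChainInterval) (h5 : ∀ t, ¬ H.IsFive t) {x y z : V} (hxy : H.To x y)
    (hyz : H.To y z) (hzx : H.To z x)
    (h3 : ∃ a b c, a ∈ H.CycleClass y z ∧ b ∈ H.CycleClass y z ∧ c ∈ H.CycleClass y z ∧
      a ≠ b ∧ a ≠ c ∧ b ≠ c) : SelfDual H := by
  have h4 : SelfDualUpTo 4 H := h.mono (by norm_num)
  have hy : ∀ u ∈ H.CycleClass z x, u = y := by
    intro u hu
    by_contra hne
    exact no_blowup hT h h3 (Ne.symm hne) (r := z) (fun p hp => hp.2)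
      (fun p hp => cycleClass_to hT h4 h5 hxy hyz hzx hp hu) hyz hu.2 (fun p hp => hp.1)
  have hz : ∀ u ∈ H.CycleClass x y, u = z := by
    intro u hu
    by_contra hne
    exact no_blowup' hT h h3 (Ne.symm hne) (r := y) (fun p hp => hp.1)
      (fun p hp => cycleClass_to hT h4 h5 hzx hxy hyz hu hp) hyz hu.1 (fun p hp => hp.2)
  refine hI.selfDual_of_caps hyz.ne.symm (H.CycleClass y z) (fun p => ⟨fun hp => ?_, fun hp => ?_⟩)
    (fun p hp => hp.1) (fun p hp => hp.2) (IsChainOn.isChainD (P := (· ∈ H.CycleClass y z)) ?_)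
  · exact ⟨hp.1.ne.symm, hp.2.ne⟩
  · rcases cycleClass_cover hT h4 hxy hyz hzx p with hd | hd | hd
    · exact hd
    · exact absurd (hy p hd) hp.2
    · exact absurd (hz p hd) hp.1
  · exact ⟨fun a b _ _ => hT a b, fun a b c ha hb hc hab hbc =>
      no_in_diamond h4 ha.2 hb.2 hc.2 hab hbc⟩

theorem selfDual_of_tournament (hT : ∀ x y, x ≠ y → H.Dir x y) (h : SelfDualUpTo 6 H)
    (hI : H.NoInfiniteChainInterval) : SelfDual H := by
  have h4 : SelfDualUpTo 4 H := h.mono (by norm_num)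
  by_cases h5 : ∃ t, H.IsFive t
  · exact h5.choose_spec.selfDual hT h
  push Not at h5
  by_cases h3 : ∃ x y z, H.To x y ∧ H.To y z ∧ H.To z x
  · obtain ⟨x, y, z, hxy, hyz, hzx⟩ := h3
    have : Nonempty V := ⟨x⟩
    by_cases hA : ∃ a b c, a ∈ H.CycleClass y z ∧ b ∈ H.CycleClass y z ∧
        c ∈ H.CycleClass y z ∧ a ≠ b ∧ a ≠ c ∧ b ≠ c
    · exact selfDual_of_large_cycleClass hT h hI h5 hxy hyz hzx hA
    by_cases hB : ∃ a b c, a ∈ H.CycleClass z x ∧ b ∈ H.CycleClass z x ∧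
        c ∈ H.CycleClass z x ∧ a ≠ b ∧ a ≠ c ∧ b ≠ c
    · exact selfDual_of_large_cycleClass hT h hI h5 hyz hzx hxy hB
    by_cases hC : ∃ a b c, a ∈ H.CycleClass x y ∧ b ∈ H.CycleClass x y ∧
        c ∈ H.CycleClass x y ∧ a ≠ b ∧ a ≠ c ∧ b ≠ c
    · exact selfDual_of_large_cycleClass hT h hI h5 hzx hxy hyz hC
    have two : ∀ P : Set V, (¬ ∃ a b c, a ∈ P ∧ b ∈ P ∧ c ∈ P ∧ a ≠ b ∧ a ≠ c ∧ b ≠ c) →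
        ∃ a b, ∀ p ∈ P, p = a ∨ p = b := by
      intro P hP
      rcases subsingleton_or_pair_of_no_three hP with ⟨a, ha⟩ | ⟨a, b, -, -, -, hab⟩
      · exact ⟨a, a, fun p hp => Or.inl (ha p hp)⟩
      · exact ⟨a, b, hab⟩
    obtain ⟨a, a', ha⟩ := two _ hA
    obtain ⟨b, b', hb⟩ := two _ hB
    obtain ⟨c, c', hc⟩ := two _ hC
    refine h.of_surjective ![a, a', b, b', c, c'] fun v => ?_
    rcases cycleClass_cover hT h4 hxy hyz hzx v with hd | hd | hd
    · rcases ha v hd with rfl | rfl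
      · exact ⟨0, rfl⟩
      · exact ⟨1, rfl⟩
    · rcases hb v hd with rfl | rfl
      · exact ⟨2, rfl⟩
      · exact ⟨3, rfl⟩
    · rcases hc v hd with rfl | rfl
      · exact ⟨4, rfl⟩
      · exact ⟨5, rfl⟩
  · push Not at h3
    refine hI.selfDual_of_isChainD ⟨hT, fun x y z hxy hyz => ?_⟩
    have hto : ∀ x y, H.Arc x y → H.To x y := fun x y hxy => by
      have hne : x ≠ y := by
        rintro rfl
        exact H.irrefl _ hxy
      exact (hT x y hne).resolve_right fun hd => hd.2 hxy
    have hne : x ≠ z := by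
      rintro rfl
      exact (hto x y hxy).2 hyz
    exact ((hT x z hne).resolve_right (h3 x y z (hto x y hxy) (hto y z hyz))).1

end Tournament
end Dgraph

namespace Dgraph
section Component

variable {V : Type*} {H G : Dgraph V}

theorem selfDualUpTo_iff {m : ℕ} : SelfDualUpTo m H ↔ (m : ℕ∞) + 1 ≤ Cdual H := by
  constructor
  · intro h
    refine le_sInf ?_
    rintro _ ⟨X, hX, hnX, rfl⟩
    by_contra hlt
    refine hnX (h X hX ?_)
    norm_cast at hlt
    omega
  · intro h X hX hc
    by_contra hnX
    have : Cdual H ≤ X.ncard := sInf_le ⟨X, hX, hnX, rfl⟩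
    have := h.trans this
    norm_cast at this
    omega

theorem selfDualUpTo_iff_leHypo {m : ℕ} : SelfDualUpTo m H ↔ LeHypo m H H.dual := by
  constructor
  · intro h j _ hj X hX hc
    exact h X hX (hc.le.trans hj)
  · intro h X hX hc
    rcases X.eq_empty_or_nonempty with rfl | hne
    · exact ⟨Equiv.refl _, fun x => x.2.elim⟩
    · exact h _ ((Set.ncard_pos hX).2 hne) hc X hX rfl

theorem IsACComponent.aCRel_ind {D : Set V} (hD : G.IsACComponent D) (x y : D) :
    (G.ind D).ACRel x y := by
  obtain ⟨a, rfl⟩ := hD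
  have key : ∀ z (hz : G.ACRel a z),
      (G.ind {y | G.ACRel a y}).ACRel ⟨a, Relation.ReflTransGen.refl⟩ ⟨z, hz⟩ := by
    intro z hz
    induction hz with
    | refl => exact Relation.ReflTransGen.refl
    | tail hb hd ih => exact Relation.ReflTransGen.tail ih hd
  have hs : Std.Symm (G.ind {y | G.ACRel a y}).Dir := ⟨fun _ _ h => h.symm⟩
  exact (Relation.ReflTransGen.stdSymm.symm _ _ (key x x.2)).trans (key y y.2)

theorem noInfiniteChainInterval_ind {D : Set V} (hD : G.IsInterval D) (hG : ¬ G.CondCinf) :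
    (G.ind D).NoInfiniteChainInterval := by
  intro I hinf hI hc
  refine hG (Or.inl ⟨Subtype.val '' I, hinf.image Subtype.val_injective.injOn, ?_, ?_, ?_⟩)
  · intro x hx
    by_cases hxD : x ∈ D
    · have hxI : (⟨x, hxD⟩ : D) ∉ I := fun h => hx ⟨_, h, rfl⟩
      simp only [Set.forall_mem_image]
      exact hI _ hxI
    · have hsub : ∀ y ∈ Subtype.val '' I, y ∈ D := by
        rintro _ ⟨y, -, rfl⟩
        exact y.2
      rcases hD x hxD with h | h | h | h
      · exact Or.inl fun y hy => h y (hsub y hy)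
      · exact Or.inr (Or.inl fun y hy => h y (hsub y hy))
      · exact Or.inr (Or.inr (Or.inl fun y hy => h y (hsub y hy)))
      · exact Or.inr (Or.inr (Or.inr fun y hy => h y (hsub y hy)))
  · rintro ⟨_, x, hx, rfl⟩ ⟨_, y, hy, rfl⟩ hne
    exact hc.1 ⟨x, hx⟩ ⟨y, hy⟩ fun h => hne (Subtype.ext (congrArg (fun t : I => (t.1 : V)) h))
  · rintro ⟨_, x, hx, rfl⟩ ⟨_, y, hy, rfl⟩ ⟨_, z, hz, rfl⟩ hxy hyz
    exact hc.2 ⟨x, hx⟩ ⟨y, hy⟩ ⟨z, hz⟩ hxy hyz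

theorem OneEndInfiniteConsecutivity.cdual_eq_top (h : H.OneEndInfiniteConsecutivity) :
    H.Cdual = ⊤ := by
  refine sInf_eq_top.2 ?_
  rintro _ ⟨X, hX, hnX, rfl⟩
  exact absurd (h.selfDual_ind hX) hnX

theorem IsPrechain.isTournament (hp : H.IsPrechain) (h : SelfDualUpTo 5 H)
    (hI : H.NoInfiniteChainInterval) (hns : ¬ SelfDual H) : H.IsTournament := by
  intro x y hxy
  by_contra hd
  refine hns (selfDual_of_neutral h (fun a b c hab hac => ?_) hI ⟨hxy, hd⟩)
  by_contra hbc
  exact hp.2.2 ⟨a, b, c, hbc, hab, hac⟩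

end Component

end Dgraph

/-- Corollary C2: non-self-dual arc-connected component intervals of a digraph not
satisfying C∞. -/
theorem corollary_C2 {V : Type u} (k : ℕ) (hk : 3 ≤ k) (G : Dgraph V)
    (hcinf : ¬ G.CondCinf) (D : Set V) (hD : G.IsACComponent D)
    (hnsd : ¬ Dgraph.SelfDual (G.ind D)) (hint : G.IsInterval D) :
    (Dgraph.LeHypo k (G.ind D) (G.ind D).dual ↔ (k : ℕ∞) + 1 ≤ Dgraph.Cdual (G.ind D)) ∧
    (Dgraph.Cdual (G.ind D) = 5 → Dgraph.ProperPrechain (G.ind D)) ∧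
    (Dgraph.Cdual (G.ind D) = 6 → Dgraph.DiamondFreeTournament (G.ind D)) ∧
    (7 ≤ Dgraph.Cdual (G.ind D) → (G.ind D).OneEndInfiniteConsecutivity) := by
  have hI := noInfiniteChainInterval_ind hint hcinf
  have hcases : SelfDualUpTo 4 (G.ind D) →
      (G.ind D).IsPrechain ∨ (G.ind D).OneEndInfiniteConsecutivity := fun h => by
    rcases prechain_or_selfDual_or_consec h hD.aCRel_ind with h | h | h
    · exact Or.inl h
    · exact absurd h hnsd
    · exact Or.inr h
  refine ⟨selfDualUpTo_iff_leHypo.symm.trans selfDualUpTo_iff, fun h => ?_, fun h => ?_,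
    fun h => ?_⟩
  · have h4 : SelfDualUpTo 4 (G.ind D) := selfDualUpTo_iff.2 (by rw [h]; norm_num)
    rcases hcases h4 with hp | hc
    · exact ⟨hp, fun hch => hnsd (hI.selfDual_of_isChainD hch)⟩
    · exact absurd (h.symm.trans hc.cdual_eq_top) (by decide)
  · have h5 : SelfDualUpTo 5 (G.ind D) := selfDualUpTo_iff.2 (by rw [h]; norm_num)
    rcases hcases (h5.mono (by norm_num)) with hp | hc
    · exact ⟨hp.isTournament h5 hI hnsd, hp.2.1⟩
    · exact absurd (h.symm.trans hc.cdual_eq_top) (by decide)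
  · have h6 : SelfDualUpTo 6 (G.ind D) := selfDualUpTo_iff.2 (le_trans (by norm_num) h)
    rcases hcases (h6.mono (by norm_num)) with hp | hc
    · exact absurd
        (selfDual_of_tournament (hp.isTournament (h6.mono (by norm_num)) hI hnsd) h6 hI) hnsd
    · exact hc
end

section
/- Let G=(V,A) and G'=(V,A') be two (≤5)-hemimorphic digraphs. If the difference relations 𝔇_{G,G'} and 𝔇_{G*,G'} each have exactly one equivalence class, then G is a chain. -/
universe u v

open Dgraph

namespace Dgraph

/-- Backtracking search for an injective map from the listed indices into `cand`, extending the
partial map `acc`, that transports the matrix `A` to the matrix `B`. -/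
def embSearch {ι : Type} [DecidableEq ι] (A B : ι → ι → Bool) (cand : List ι) :
    List ι → List (ι × ι) → Bool
  | [], _ => true
  | i :: r, acc => cand.any fun p =>
      (acc.all fun q => !decide (q.2 = p) && (A i q.1 == B p q.2) && (A q.1 i == B q.2 p)) &&
        embSearch A B cand r ((i, p) :: acc)

theorem embSearch_eq_true {ι : Type} [DecidableEq ι] {A B : ι → ι → Bool} {cand : List ι}
    (σ : Equiv.Perm ι) (hσ : ∀ i j, A i j = B (σ i) (σ j)) (hc : ∀ i, i ∈ cand) :
    ∀ (l : List ι) (acc : List (ι × ι)), l.Nodup → (∀ q ∈ acc, q.2 = σ q.1 ∧ q.1 ∉ l) →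
      embSearch A B cand l acc = true := by
  intro l
  induction l with
  | nil => intros; rfl
  | cons i r ih =>
    intro acc hl hacc
    rw [List.nodup_cons] at hl
    simp only [embSearch, List.any_eq_true, Bool.and_eq_true, List.all_eq_true]
    refine ⟨σ i, hc _, fun q hq => ?_, ih _ hl.2 ?_⟩
    · obtain ⟨h1, h2⟩ := hacc q hq
      have h3 : q.1 ≠ i := fun h => h2 (by simp [h])
      simp [h1, hσ, h3]
    · intro q hq
      rcases List.mem_cons.1 hq with rfl | hq
      · exact ⟨rfl, hl.1⟩
      · exact ⟨(hacc q hq).1, fun h => (hacc q hq).2 (List.mem_cons_of_mem _ h)⟩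

/-- Decision procedure for hemimorphy of the digraphs on `Fin n` with adjacency matrices `A`
and `B`. -/
def hemiSearch {n : ℕ} (A B : Fin n → Fin n → Bool) : Bool :=
  embSearch A B (List.finRange n) (List.finRange n) [] ||
    embSearch (fun i j => A j i) B (List.finRange n) (List.finRange n) []

variable {V : Type u}

theorem Iso.exists_perm {n : ℕ} {G G' : Dgraph V} {x : Fin n → V} (hx : Function.Injective x)
    (h : Iso (G.ind (Set.range x)) (G'.ind (Set.range x))) :
    ∃ σ : Equiv.Perm (Fin n), ∀ i j, G.Arc (x i) (x j) ↔ G'.Arc (x (σ i)) (x (σ j)) := by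
  obtain ⟨e, he⟩ := h
  let f := Equiv.ofInjective x hx
  refine ⟨(f.trans e).trans f.symm, fun i j => ?_⟩
  have key : ∀ i, x (((f.trans e).trans f.symm) i) = (e (f i)).1 := fun i =>
    congrArg Subtype.val (f.apply_symm_apply (e (f i)))
  rw [key, key]
  exact he (f i) (f j)

theorem LeHemi.hemiSearch_eq_true {n k : ℕ} {G G' : Dgraph V} (h : LeHemi k G G')
    (h1 : 1 ≤ n) (hk : n ≤ k) {x : Fin n → V} (hx : Function.Injective x)
    {A B : Fin n → Fin n → Bool}
    (hA : ∀ i j, A i j = true ↔ G.Arc (x i) (x j))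
    (hB : ∀ i j, B i j = true ↔ G'.Arc (x i) (x j)) :
    hemiSearch A B = true := by
  have hcard : (Set.range x).ncard = n := by
    rw [← Set.image_univ, Set.ncard_image_of_injective _ hx]; simp
  rw [hemiSearch, Bool.or_eq_true]
  refine (h n h1 hk _ (Set.finite_range x) hcard).imp (fun h => ?_) (fun h => ?_)
  · obtain ⟨σ, hσ⟩ := Iso.exists_perm hx h
    refine embSearch_eq_true σ (fun i j => ?_) List.mem_finRange _ _ (List.nodup_finRange n)
      (by simp)
    rw [Bool.eq_iff_iff, hB, hA]
    exact hσ _ _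
  · obtain ⟨σ, hσ⟩ := Iso.exists_perm (G := G.dual) hx h
    refine embSearch_eq_true σ (fun i j => ?_) List.mem_finRange _ _ (List.nodup_finRange n)
      (by simp)
    rw [Bool.eq_iff_iff, hB, hA]
    exact hσ _ _

theorem hemiSearch_pair : ∀ a b a' b' : Bool,
    hemiSearch ![![false, a], ![b, false]] ![![false, a'], ![b', false]] = true →
      (a' = a ∧ b' = b) ∨ (a' = b ∧ b' = a) := by
  decide +kernel

theorem hemiSearch_neutral_base : ∀ ν d e c : Bool,
    hemiSearch ![![false, d, e], ![!d, false, ν], ![!e, ν, false]]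
      ![![false, d ^^ c, e ^^ !c], ![!(d ^^ c), false, ν], ![!(e ^^ !c), ν, false]] = false := by
  decide +kernel

theorem hemiSearch_cycle : ∀ c₀ c₁ c₂ : Bool,
    hemiSearch ![![false, true, false], ![false, false, true], ![true, false, false]]
      ![![false, !c₀, c₂], ![c₀, false, !c₁], ![!c₂, c₁, false]] = true → c₀ = c₁ ∧ c₁ = c₂ := by
  decide +kernel

theorem hemiSearch_transitive : ∀ c : Bool,
    hemiSearch ![![false, true, true], ![false, false, true], ![false, false, false]]
      ![![false, !c, c], ![c, false, !c], ![!c, c, false]] = false := by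
  decide +kernel

theorem hemiSearch_neutral_two : ∀ ν zu zv wu wv c p f : Bool,
    hemiSearch
      ![![false, ν, !zu, !wu], ![ν, false, !zv, !wv], ![zu, zv, false, p], ![wu, wv, !p, false]]
      ![![false, ν, !(zu ^^ c), wu ^^ c], ![ν, false, !(zv ^^ c), wv ^^ c],
        ![zu ^^ c, zv ^^ c, false, p ^^ f],
        ![!(wu ^^ c), !(wv ^^ c), !(p ^^ f), false]] = true →
      (zu = (!zv) ∧ wu = wv ∧ f = !c) ∨
        (wu = (!wv) ∧ zu = zv ∧ f = c) := by
  decide +kernel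

theorem hemiSearch_cycle_two : ∀ w t c p q f : Bool,
    hemiSearch
      ![![false, true, false, !w, !t], ![false, false, true, !w, !t],
        ![true, false, false, !w, !t], ![w, w, w, false, p], ![t, t, t, q, false]]
      ![![false, !c, c, w ^^ c, !(t ^^ c)], ![c, false, !c, w ^^ c, !(t ^^ c)],
        ![!c, c, false, w ^^ c, !(t ^^ c)],
        ![!(w ^^ c), !(w ^^ c), !(w ^^ c), false, if f then q else p],
        ![t ^^ c, t ^^ c, t ^^ c, if f then p else q, false]] = false := by
  decide +kernel


/-- A partition of the pairs of vertices into neutral pairs and directed pairs of two colours,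
subject to the constraints that two `(≤ 5)`-hemimorphic digraphs impose when a directed pair is
coloured according to whether the two digraphs orient it alike. -/
structure BicoloredDigraph (V : Type u) where
  D : Bool → V → V → Prop
  N : V → V → Prop
  total : ∀ {x y}, x ≠ y → N x y ∨ ∃ c, D c x y ∨ D c y x
  color_eq : ∀ {c c' x y}, D c x y → D c' x y → c = c'
  asymm : ∀ {c c' x y}, D c x y → ¬ D c' y x
  not_neutral : ∀ {c x y}, D c x y → ¬ N x y
  neutral_symm : ∀ {x y}, N x y → N y x
  neutral_irrefl : ∀ {x}, ¬ N x x
  neutral_base : ∀ {c c' x y z}, N y z → (D c x y ∨ D c y x) → (D c' x z ∨ D c' z x) → c = c'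
  cycle : ∀ {c c' c'' x y z}, D c x y → D c' y z → D c'' z x → c = c'
  transitive : ∀ {c c' x y z}, D c x y → D c y z → D c' x z → c' = c
  neutral_two : ∀ {c u v z w}, N u v → (D c z u ∨ D c u z) → (D c z v ∨ D c v z) →
    (D (!c) w u ∨ D (!c) u w) → (D (!c) w v ∨ D (!c) v w) →
    (((D c u z ∧ D c z v) ∨ (D c v z ∧ D c z u)) ∧
      ((D (!c) w u ∧ D (!c) w v) ∨ (D (!c) u w ∧ D (!c) v w)) ∧ (D (!c) w z ∨ D (!c) z w)) ∨
    (((D (!c) u w ∧ D (!c) w v) ∨ (D (!c) v w ∧ D (!c) w u)) ∧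
      ((D c z u ∧ D c z v) ∨ (D c u z ∧ D c v z)) ∧ (D c w z ∨ D c z w))
  cycle_two : ∀ {c x y z w t}, D c x y → D c y z → D c z x →
    ((D (!c) w x ∧ D (!c) w y ∧ D (!c) w z) ∨ (D (!c) x w ∧ D (!c) y w ∧ D (!c) z w)) →
    ((D c t x ∧ D c t y ∧ D c t z) ∨ (D c x t ∧ D c y t ∧ D c z t)) → False

namespace BicoloredDigraph

variable {V : Type u} (B : BicoloredDigraph V)

/-- Reversal of all the arcs. -/
def dual : BicoloredDigraph V where
  D c x y := B.D c y x
  N := B.N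
  total h := (B.total h).imp_right fun ⟨c, h⟩ => ⟨c, h.symm⟩
  color_eq := B.color_eq
  asymm := B.asymm
  not_neutral h h' := B.not_neutral h (B.neutral_symm h')
  neutral_symm := B.neutral_symm
  neutral_irrefl := B.neutral_irrefl
  neutral_base h h1 h2 := B.neutral_base h h1.symm h2.symm
  cycle h1 h2 h3 := (B.cycle h2 h1 h3).symm
  transitive h1 h2 h3 := B.transitive h2 h1 h3
  neutral_two h h1 h2 h3 h4 := by
    rcases B.neutral_two h h1.symm h2.symm h3.symm h4.symm with ⟨h1, h2, h3⟩ | ⟨h1, h2, h3⟩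
    · exact Or.inl ⟨h1.symm.imp And.symm And.symm, h2.symm, h3.symm⟩
    · exact Or.inr ⟨h1.symm.imp And.symm And.symm, h2.symm, h3.symm⟩
  cycle_two h1 h2 h3 h4 h5 := B.cycle_two h2 h1 h3
    (h4.symm.imp (fun ⟨h, h', h''⟩ => ⟨h'', h', h⟩) fun ⟨h, h', h''⟩ => ⟨h'', h', h⟩)
    (h5.symm.imp (fun ⟨h, h', h''⟩ => ⟨h'', h', h⟩) fun ⟨h, h', h''⟩ => ⟨h'', h', h⟩)

/-- `{x, y}` is a directed pair of colour `c`. -/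
def Adj (c : Bool) (x y : V) : Prop := B.D c x y ∨ B.D c y x

/-- A monochromatic `3`-cycle or directed path with neutral ends. -/
def Rigid (c : Bool) (x y z : V) : Prop := B.D c x y ∧ B.D c y z ∧ (B.D c z x ∨ B.N z x)

/-- `w` dominates the three other vertices, or is dominated by them. -/
def Uniform (c : Bool) (w x y z : V) : Prop :=
  (B.D c w x ∧ B.D c w y ∧ B.D c w z) ∨ (B.D c x w ∧ B.D c y w ∧ B.D c z w)

/-- `y` lies in a rigid triple of colour `c` to which `w` is uniformly linked with the other
colour. -/
def Linked (c : Bool) (w y : V) : Prop :=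
  ∃ p q r, B.Rigid c p q r ∧ B.Uniform (!c) w p q r ∧ (y = p ∨ y = q ∨ y = r)

variable {B} {c : Bool} {x y z w t u v : V}

theorem adj_symm (h : B.Adj c x y) : B.Adj c y x := h.symm

theorem adj_dual : B.dual.Adj c x y ↔ B.Adj c x y := or_comm

theorem ne_of_D (h : B.D c x y) : x ≠ y := by
  rintro rfl; exact B.asymm h h

theorem ne_of_adj (h : B.Adj c x y) : x ≠ y := h.elim ne_of_D fun h => (ne_of_D h).symm

theorem not_adj_not (h : B.Adj c x y) : ¬ B.Adj (!c) x y := by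
  intro h'
  rcases h with h | h <;> rcases h' with h' | h'
  · exact (Bool.not_ne_self c).symm (B.color_eq h h')
  · exact B.asymm h h'
  · exact B.asymm h h'
  · exact (Bool.not_ne_self c).symm (B.color_eq h h')

theorem not_neutral_of_adj (h : B.Adj c x y) : ¬ B.N x y := by
  rcases h with h | h
  · exact B.not_neutral h
  · exact fun h' => B.not_neutral h (B.neutral_symm h')

theorem neutral_or_adj (h : x ≠ y) (c : Bool) : B.N x y ∨ B.Adj c x y ∨ B.Adj (!c) x y := by
  rcases B.total h with h | ⟨c', h⟩
  · exact Or.inl h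
  · rcases Bool.eq_or_eq_not c' c with rfl | rfl
    · exact Or.inr (Or.inl h)
    · exact Or.inr (Or.inr h)

theorem adj_of_neutral (h : B.N y z) (hy : B.Adj c x y) (hz : x ≠ z) :
    B.N x z ∨ B.Adj c x z := by
  rcases neutral_or_adj hz c with h1 | h1 | h1
  · exact Or.inl h1
  · exact Or.inr h1
  · exact absurd (B.neutral_base h hy h1) ((Bool.not_ne_self c).symm)

theorem rigid_or_D (h1 : B.D c x y) (h2 : B.D c y z) (h : x ≠ z) :
    B.Rigid c x y z ∨ B.D c x z := by
  rcases neutral_or_adj h c with h3 | (h3 | h3) | (h3 | h3)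
  · exact Or.inl ⟨h1, h2, Or.inr (B.neutral_symm h3)⟩
  · exact Or.inr h3
  · exact Or.inl ⟨h1, h2, Or.inl h3⟩
  · exact absurd (B.transitive h1 h2 h3) ((Bool.not_ne_self c))
  · exact absurd (B.cycle h2 h3 h1) ((Bool.not_ne_self c).symm)

theorem Rigid.dual (h : B.Rigid c x y z) : B.dual.Rigid c z y x :=
  ⟨h.2.1, h.1, h.2.2.imp_right B.neutral_symm⟩

theorem Uniform.dual (h : B.Uniform c w x y z) : B.dual.Uniform c w z y x := by
  rcases h with ⟨h1, h2, h3⟩ | ⟨h1, h2, h3⟩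
  · exact Or.inr ⟨h3, h2, h1⟩
  · exact Or.inl ⟨h3, h2, h1⟩

theorem Linked.dual (h : B.Linked c w y) : B.dual.Linked c w y := by
  obtain ⟨p, q, r, h1, h2, h3⟩ := h
  exact ⟨r, q, p, h1.dual, h2.dual, by tauto⟩

theorem D_or_D_of_dominated (hx : B.D (!c) w x) (h : B.D c x y) (hy : w ≠ y) :
    B.D (!c) w y ∨ B.D c w y := by
  rcases neutral_or_adj hy c with h1 | (h1 | h1) | (h1 | h1)
  · exact absurd (B.neutral_base h1 (Or.inr hx) (Or.inl h)) (Bool.not_ne_self c)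
  · exact Or.inr h1
  · exact absurd (B.cycle hx h h1) (Bool.not_ne_self c)
  · exact Or.inl h1
  · exact absurd (B.cycle hx h h1) (Bool.not_ne_self c)

/-- A vertex dominating two vertices of a rigid triple, with the other colour, dominates it. -/
theorem Rigid.dominated (h : B.Rigid c x y z) (hx : w ≠ x) (hy : w ≠ y) (hz : w ≠ z)
    (hw : (B.D (!c) w x ∧ B.D (!c) w y) ∨ (B.D (!c) w y ∧ B.D (!c) w z) ∨
      (B.D (!c) w x ∧ B.D (!c) w z)) :
    B.D (!c) w x ∧ B.D (!c) w y ∧ B.D (!c) w z := by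
  obtain ⟨h1, h2, h3⟩ := h
  rcases hw with ⟨ha, hb⟩ | ⟨ha, hb⟩ | ⟨ha, hb⟩
  · refine ⟨ha, hb, (D_or_D_of_dominated hb h2 hz).resolve_right fun h4 => ?_⟩
    rcases h3 with h3 | h3
    · exact Bool.not_ne_self c (B.transitive h4 h3 ha)
    · exact Bool.not_ne_self c (B.neutral_base h3 (Or.inl h4) (Or.inl ha)).symm
  · refine ⟨?_, ha, hb⟩
    rcases h3 with h3 | h3
    · refine (D_or_D_of_dominated hb h3 hx).resolve_right fun h4 => ?_
      exact Bool.not_ne_self c (B.transitive h4 h1 ha)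
    · rcases adj_of_neutral h3 (Or.inl hb) hx with h4 | h4 | h4
      · exact absurd (B.neutral_base h4 (Or.inr ha) (Or.inr h1)) (Bool.not_ne_self c)
      · exact h4
      · exact absurd (B.transitive h4 ha h1).symm (Bool.not_ne_self c)
  · refine ⟨ha, (D_or_D_of_dominated ha h1 hy).resolve_right fun h4 => ?_, hb⟩
    exact Bool.not_ne_self c (B.transitive h4 h2 hb)

theorem Rigid.uniform_of_two (h : B.Rigid c x y z) (hx : w ≠ x) (hy : w ≠ y) (hz : w ≠ z)
    (hw : (B.D (!c) w x ∧ B.D (!c) w y) ∨ (B.D (!c) w y ∧ B.D (!c) w z) ∨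
      (B.D (!c) w x ∧ B.D (!c) w z) ∨ (B.D (!c) x w ∧ B.D (!c) y w) ∨
      (B.D (!c) y w ∧ B.D (!c) z w) ∨ (B.D (!c) x w ∧ B.D (!c) z w)) :
    B.Uniform (!c) w x y z := by
  by_cases h' : (B.D (!c) w x ∧ B.D (!c) w y) ∨ (B.D (!c) w y ∧ B.D (!c) w z) ∨
      (B.D (!c) w x ∧ B.D (!c) w z)
  · exact Or.inl (h.dominated hx hy hz h')
  · obtain ⟨h1, h2, h3⟩ := h.dual.dominated hz hy hx
      (show (B.D (!c) z w ∧ B.D (!c) y w) ∨ (B.D (!c) y w ∧ B.D (!c) x w) ∨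
        (B.D (!c) z w ∧ B.D (!c) x w) by tauto)
    exact Or.inr ⟨h3, h2, h1⟩

/-- No two vertices are uniformly linked to a rigid triple with different colours. -/
theorem Rigid.not_uniform (h : B.Rigid c x y z) (hw : B.Uniform (!c) w x y z) :
    ¬ B.Uniform c t x y z := by
  intro ht
  obtain ⟨h1, h2, h3 | h3⟩ := h
  · exact B.cycle_two h1 h2 h3 hw ht
  · have ha := B.neutral_two (c := c) (z := t) (w := w) h3 (ht.imp (·.2.2) (·.2.2))
      (ht.imp (·.1) (·.1)) (hw.imp (·.2.2) (·.2.2)) (hw.imp (·.1) (·.1))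
    have h4 := @B.asymm
    grind [Uniform]

theorem not_uniform_peak (huv : B.N u v) (hw : B.Uniform (!c) w u v z) :
    ¬ ((B.D c z u ∧ B.D c z v) ∨ (B.D c u z ∧ B.D c v z)) := by
  intro ht
  have ha := B.neutral_two (c := c) (z := z) (w := w) huv (ht.imp (·.1) (·.1))
    (ht.imp (·.2) (·.2)) (hw.imp (·.1) (·.1)) (hw.imp (·.2.1) (·.2.1))
  have h4 := @B.asymm
  grind [Uniform]

/-- Two vertices `z`, `w` linked with different colours to a neutral pair form with it a rigid
triple and a vertex uniformly linked to it. -/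
theorem exists_rigid_of_neutral (huv : B.N u v) (hu : B.Adj c z u) (hv : B.Adj c z v)
    (hu' : B.Adj (!c) w u) (hv' : B.Adj (!c) w v) :
    ∃ c' p q r t, B.Rigid c' p q r ∧ B.Uniform (!c') t p q r := by
  have key : ∀ {c u v z w}, B.N u v → B.D c u z → B.D c z v →
      ((B.D (!c) w u ∧ B.D (!c) w v) ∨ (B.D (!c) u w ∧ B.D (!c) v w)) → w ≠ z →
      B.Rigid c u z v ∧ B.Uniform (!c) w u z v := by
    intro c u v z w huv h1 h2 h3 h4
    have hr : B.Rigid c u z v := ⟨h1, h2, Or.inr (B.neutral_symm huv)⟩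
    refine ⟨hr, hr.uniform_of_two ?_ h4 ?_ (by tauto)⟩
    · rcases h3 with h3 | h3
      · exact ne_of_D h3.1
      · exact (ne_of_D h3.1).symm
    · rcases h3 with h3 | h3
      · exact ne_of_D h3.2
      · exact (ne_of_D h3.2).symm
  rcases B.neutral_two huv hu hv hu' hv' with
    ⟨h1 | h1, h2, h3⟩ | ⟨h1 | h1, h2, h3⟩
  · exact ⟨_, _, _, _, _, key huv h1.1 h1.2 h2 (ne_of_adj h3)⟩
  · exact ⟨_, _, _, _, _, key (B.neutral_symm huv) h1.1 h1.2 (by tauto) (ne_of_adj h3)⟩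
  · refine ⟨_, _, _, _, z, key huv h1.1 h1.2 ?_ (ne_of_adj h3).symm⟩
    simpa using h2
  · refine ⟨_, _, _, _, z, key (B.neutral_symm huv) h1.1 h1.2 ?_ (ne_of_adj h3).symm⟩
    simpa [and_comm] using h2

theorem Rigid.linked_of_two (h : B.Rigid c x y z) (hx : w ≠ x) (hy : w ≠ y) (hz : w ≠ z)
    (hw : (B.D (!c) w x ∧ B.D (!c) w y) ∨ (B.D (!c) w y ∧ B.D (!c) w z) ∨
      (B.D (!c) w x ∧ B.D (!c) w z) ∨ (B.D (!c) x w ∧ B.D (!c) y w) ∨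
      (B.D (!c) y w ∧ B.D (!c) z w) ∨ (B.D (!c) x w ∧ B.D (!c) z w))
    (ht : t = x ∨ t = y ∨ t = z) : B.Linked c w t :=
  ⟨_, _, _, h, h.uniform_of_two hx hy hz hw, ht⟩

theorem Linked.of_dual (h : B.dual.Linked c w y) : B.Linked c w y :=
  Linked.dual h

theorem Uniform.ne (h : B.Uniform c w x y z) : w ≠ x ∧ w ≠ y ∧ w ≠ z := by
  rcases h with ⟨h1, h2, h3⟩ | ⟨h1, h2, h3⟩
  · exact ⟨ne_of_D h1, ne_of_D h2, ne_of_D h3⟩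
  · exact ⟨(ne_of_D h1).symm, (ne_of_D h2).symm, (ne_of_D h3).symm⟩

theorem Uniform.rotate (h : B.Uniform c w x y z) : B.Uniform c w y z x :=
  h.imp (fun ⟨h1, h2, h3⟩ => ⟨h2, h3, h1⟩) fun ⟨h1, h2, h3⟩ => ⟨h2, h3, h1⟩

theorem Uniform.adj (h : B.Uniform c w x y z) : B.Adj c w x ∧ B.Adj c w y ∧ B.Adj c w z := by
  rcases h with ⟨h1, h2, h3⟩ | ⟨h1, h2, h3⟩
  · exact ⟨Or.inl h1, Or.inl h2, Or.inl h3⟩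
  · exact ⟨Or.inr h1, Or.inr h2, Or.inr h3⟩

theorem ne_of_adj_not (hx : B.Adj (!c) w x) (ht : B.Adj c x t) : w ≠ t := by
  rintro rfl
  exact not_adj_not (adj_symm ht) hx

theorem linked_of_cycle_of_D (h1 : B.D c x y) (h2 : B.D c y z) (h3 : B.D c z x)
    (hw : B.Uniform (!c) w x y z) (ht : B.D c x t) : B.Linked c w t := by
  have hr : B.Rigid c x y z := ⟨h1, h2, Or.inl h3⟩
  by_cases hty : t = y
  · exact ⟨_, _, _, hr, hw, Or.inr (Or.inl hty)⟩
  by_cases htz : t = z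
  · exact ⟨_, _, _, hr, hw, Or.inr (Or.inr htz)⟩
  have hwt : w ≠ t := ne_of_adj_not hw.adj.1 (Or.inl ht)
  obtain ⟨hwx, hwy, hwz⟩ := hw.ne
  rcases rigid_or_D h3 ht (Ne.symm htz) with h4 | h4
  · exact h4.linked_of_two hwz hwx hwt (by unfold Uniform at hw; tauto) (by simp)
  rcases rigid_or_D h2 h4 (Ne.symm hty) with h5 | h5
  · exact h5.linked_of_two hwy hwz hwt (by unfold Uniform at hw; tauto) (by simp)
  exact absurd (Or.inr ⟨ht, h5, h4⟩) (hr.not_uniform hw)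

theorem linked_of_cycle (h1 : B.D c x y) (h2 : B.D c y z) (h3 : B.D c z x)
    (hw : B.Uniform (!c) w x y z) (ht : B.Adj c x t) : B.Linked c w t := by
  rcases ht with ht | ht
  · exact linked_of_cycle_of_D h1 h2 h3 hw ht
  · exact Linked.of_dual
      (linked_of_cycle_of_D (B := B.dual) h3 h2 h1 hw.rotate.dual ht)

theorem D_iff_D_of_adj_not (hx : B.Adj (!c) w x) (h : B.D c x t) (ht : B.Adj (!c) w t) :
    (B.D (!c) w x ∧ B.D (!c) w t) ∨ (B.D (!c) x w ∧ B.D (!c) t w) := by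
  rcases hx with hx | hx <;> rcases ht with ht | ht
  · exact Or.inl ⟨hx, ht⟩
  · exact absurd (B.cycle hx h ht) (Bool.not_ne_self c)
  · exact absurd (B.transitive hx ht h) (Bool.not_ne_self c).symm
  · exact Or.inr ⟨hx, ht⟩

theorem linked_of_path_of_source_D (h1 : B.D c x y) (h2 : B.D c y z) (h3 : B.N z x)
    (hw : B.Uniform (!c) w x y z) (ht : B.D c x t) : B.Linked c w t := by
  have hr : B.Rigid c x y z := ⟨h1, h2, Or.inr h3⟩
  by_cases hty : t = y
  · exact ⟨_, _, _, hr, hw, Or.inr (Or.inl hty)⟩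
  have htz : t ≠ z := by
    rintro rfl
    exact B.not_neutral ht (B.neutral_symm h3)
  have hwt : w ≠ t := ne_of_adj_not hw.adj.1 (Or.inl ht)
  obtain ⟨hwx, hwy, hwz⟩ := hw.ne
  -- a neutral partner of `t` in the path makes `w` uniformly linked to `t` as well
  have hdir : ∀ {s}, B.N s t → B.Adj (!c) w s →
      (B.D (!c) w x ∧ B.D (!c) w t) ∨ (B.D (!c) x w ∧ B.D (!c) t w) := by
    intro s hs hws
    refine D_iff_D_of_adj_not hw.adj.1 ht ((adj_of_neutral hs hws hwt).resolve_left fun h => ?_)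
    exact Bool.not_ne_self c (B.neutral_base h (adj_symm hw.adj.1) (Or.inl ht))
  rcases adj_of_neutral (B.neutral_symm h3) (Or.inr ht) htz with htz' | htz' | htz'
  · rcases adj_of_neutral (B.neutral_symm htz') (Or.inl h2) (Ne.symm hty) with hyt | hyt | hyt
    · have hd := hdir hyt hw.adj.2.1
      have hu : B.Uniform (!c) w y t x := by
        rcases hw with hw | hw <;> rcases hd with hd | hd
        · exact Or.inl ⟨hw.2.1, hd.2, hw.1⟩
        · exact absurd hw.1 (B.asymm hd.1)
        · exact absurd hw.1 (B.asymm hd.1)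
        · exact Or.inr ⟨hw.2.1, hd.2, hw.1⟩
      exact absurd (Or.inl ⟨h1, ht⟩) (not_uniform_peak hyt hu)
    · have hd := hdir (B.neutral_symm htz') hw.adj.2.2
      have hu : B.Uniform (!c) w z t y := by
        rcases hw with hw | hw <;> rcases hd with hd | hd
        · exact Or.inl ⟨hw.2.2, hd.2, hw.2.1⟩
        · exact absurd hw.1 (B.asymm hd.1)
        · exact absurd hw.1 (B.asymm hd.1)
        · exact Or.inr ⟨hw.2.2, hd.2, hw.2.1⟩
      exact absurd (Or.inl ⟨h2, hyt⟩) (not_uniform_peak (B.neutral_symm htz') hu)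
    · have h5 : B.Rigid c t y z := ⟨hyt, h2, Or.inr (B.neutral_symm htz')⟩
      exact h5.linked_of_two hwt hwy hwz (by unfold Uniform at hw; tauto) (by simp)
  · have h5 : B.Rigid c x t z := ⟨ht, htz', Or.inr h3⟩
    exact h5.linked_of_two hwx hwt hwz (by unfold Uniform at hw; tauto) (by simp)
  · rcases rigid_or_D h2 htz' (Ne.symm hty) with h5 | h5
    · exact h5.linked_of_two hwy hwz hwt (by unfold Uniform at hw; tauto) (by simp)
    · exact absurd (Or.inr ⟨ht, h5, htz'⟩) (hr.not_uniform hw)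

theorem linked_of_path_of_D_source (h1 : B.D c x y) (h2 : B.D c y z) (h3 : B.N z x)
    (hw : B.Uniform (!c) w x y z) (ht : B.D c t x) : B.Linked c w t := by
  have hr : B.Rigid c x y z := ⟨h1, h2, Or.inr h3⟩
  have hty : t ≠ y := by
    rintro rfl
    exact B.asymm h1 ht
  have htz : t ≠ z := by
    rintro rfl
    exact B.not_neutral ht h3
  have hwt : w ≠ t := ne_of_adj_not hw.adj.1 (Or.inr ht)
  obtain ⟨hwx, hwy, hwz⟩ := hw.ne
  rcases rigid_or_D ht h1 hty with h4 | h4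
  · exact h4.linked_of_two hwt hwx hwy (by unfold Uniform at hw; tauto) (by simp)
  rcases rigid_or_D h4 h2 htz with h5 | h5
  · exact h5.linked_of_two hwt hwy hwz (by unfold Uniform at hw; tauto) (by simp)
  exact absurd (Or.inl ⟨ht, h4, h5⟩) (hr.not_uniform hw)

theorem linked_of_path_of_middle_D (h1 : B.D c x y) (h2 : B.D c y z) (h3 : B.N z x)
    (hw : B.Uniform (!c) w x y z) (ht : B.D c y t) : B.Linked c w t := by
  have htx : x ≠ t := by
    rintro rfl
    exact B.asymm h1 ht
  obtain ⟨hwx, hwy, hwz⟩ := hw.ne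
  rcases rigid_or_D h1 ht htx with h4 | h4
  · exact h4.linked_of_two hwx hwy (ne_of_adj_not hw.adj.2.1 (Or.inl ht))
      (by unfold Uniform at hw; tauto) (by simp)
  · exact linked_of_path_of_source_D h1 h2 h3 hw h4

theorem Linked.step (h : B.Linked c w x) (ht : B.Adj c x t) : B.Linked c w t := by
  obtain ⟨p, q, r, ⟨h1, h2, h3 | h3⟩, hw, rfl | rfl | rfl⟩ := h
  · exact linked_of_cycle h1 h2 h3 hw ht
  · exact linked_of_cycle h2 h3 h1 hw.rotate ht
  · exact linked_of_cycle h3 h1 h2 hw.rotate.rotate ht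
  · rcases ht with ht | ht
    · exact linked_of_path_of_source_D h1 h2 h3 hw ht
    · exact linked_of_path_of_D_source h1 h2 h3 hw ht
  · rcases ht with ht | ht
    · exact linked_of_path_of_middle_D h1 h2 h3 hw ht
    · exact Linked.of_dual (linked_of_path_of_middle_D (B := B.dual) h2 h1 (B.neutral_symm h3)
        hw.dual ht)
  · rcases ht with ht | ht
    · exact Linked.of_dual (linked_of_path_of_D_source (B := B.dual) h2 h1 (B.neutral_symm h3)
        hw.dual ht)
    · exact Linked.of_dual (linked_of_path_of_source_D (B := B.dual) h2 h1 (B.neutral_symm h3)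
        hw.dual ht)

/-- No vertex is uniformly linked to a rigid triple with the other colour. -/
theorem Rigid.not_uniform_not (hconn : ∀ c x y, Relation.ReflTransGen (B.Adj c) x y)
    (h : B.Rigid c x y z) : ¬ B.Uniform (!c) w x y z := by
  intro hw
  have key : ∀ t, Relation.ReflTransGen (B.Adj c) x t → B.Linked c w t := by
    intro t ht
    induction ht with
    | refl => exact ⟨_, _, _, h, hw, Or.inl rfl⟩
    | tail _ h1 ih => exact ih.step h1
  obtain ⟨p, q, r, -, h1, h2⟩ := key w (hconn c x w)
  obtain ⟨hp, hq, hr⟩ := h1.ne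
  tauto

theorem not_neutral_of_connected (hconn : ∀ c x y, Relation.ReflTransGen (B.Adj c) x y) :
    ¬ B.N x y := by
  intro hxy
  obtain ⟨u, z, hu, hzu, hzy⟩ : ∃ u z, B.N u y ∧ B.Adj true z u ∧ B.Adj true z y := by
    by_contra! hno
    have key : ∀ t, Relation.ReflTransGen (B.Adj true) x t → B.N t y := by
      intro t ht
      induction ht with
      | refl => exact hxy
      | @tail b t _ h1 ih =>
        have hty : t ≠ y := by
          rintro rfl
          exact not_neutral_of_adj h1 ih
        exact (adj_of_neutral ih (adj_symm h1) hty).resolve_right (hno b t ih (adj_symm h1))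
    exact B.neutral_irrefl (key y (hconn true x y))
  have key : ∀ t, Relation.ReflTransGen (B.Adj (!true)) u t →
      B.N t y ∧ B.Adj true z t := by
    intro t ht
    induction ht with
    | refl => exact ⟨hu, hzu⟩
    | @tail b t _ h1 ih =>
      obtain ⟨hb, hzb⟩ := ih
      have hty : t ≠ y := by
        rintro rfl
        exact not_neutral_of_adj h1 hb
      have hzt : z ≠ t := by
        rintro rfl
        exact not_adj_not (adj_symm hzb) h1
      rcases adj_of_neutral hb (adj_symm h1) hty with h2 | h2
      · refine ⟨h2, (adj_of_neutral (B.neutral_symm h2) hzy hzt).resolve_left fun h3 => ?_⟩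
        exact absurd (B.neutral_base h3 (adj_symm hzb) h1) (Bool.not_ne_self true).symm
      · obtain ⟨c', p, q, r, s, hr, hs⟩ :=
          exists_rigid_of_neutral hb hzb hzy (adj_symm h1) h2
        exact absurd hs (Rigid.not_uniform_not hconn hr)
  exact ne_of_adj (key z (hconn (!true) u z)).2 rfl

/-- A vertex dominated, in the other colour, by a vertex of a monochromatic cycle can replace it in
the cycle. -/
theorem cycle_step (hconn : ∀ c x y, Relation.ReflTransGen (B.Adj c) x y)
    (h1 : B.D c x y) (h2 : B.D c y z) (h3 : B.D c z x) (ht : B.D (!c) x t) :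
    B.D c t y ∧ B.D c z t := by
  have hN : ∀ {x y}, ¬ B.N x y := not_neutral_of_connected hconn
  have hty : t ≠ y := by
    rintro rfl
    exact Bool.not_ne_self c (B.color_eq ht h1)
  have htz : t ≠ z := by
    rintro rfl
    exact B.asymm ht h3
  have hzt : ∃ c', B.D c' z t := by
    obtain ⟨c', h | h⟩ := (B.total htz).resolve_left hN
    · exact absurd (B.cycle h3 ht h).symm (Bool.not_ne_self c)
    · exact ⟨c', h⟩
  obtain ⟨c', hzt⟩ := hzt
  obtain ⟨c'', h | h⟩ := (B.total hty).resolve_left hN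
  · have e1 := B.cycle h h2 hzt
    have e2 := B.cycle h2 hzt h
    subst e1 e2
    exact ⟨h, hzt⟩
  · have e1 : c'' = !c := by
      by_contra hne
      have : c'' = c := by simpa using hne
      subst this
      exact Bool.not_ne_self _ (B.transitive h1 h ht)
    have e2 : c' = !c := by
      by_contra hne
      have : c' = c := by simpa using hne
      subst this
      exact Bool.not_ne_self _ (e1 ▸ B.transitive h2 hzt h)
    subst e1 e2
    exact absurd (Or.inr ⟨ht, h, hzt⟩)
      (Rigid.not_uniform_not (w := t) hconn (⟨h1, h2, Or.inl h3⟩ : B.Rigid c x y z))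

theorem not_cycle (hconn : ∀ c x y, Relation.ReflTransGen (B.Adj c) x y)
    (h1 : B.D c x y) (h2 : B.D c y z) (h3 : B.D c z x) : False := by
  have hconn' : ∀ c x y, Relation.ReflTransGen (B.dual.Adj c) x y := fun c x y =>
    (hconn c x y).lift id fun _ _ => adj_dual.2
  have key : ∀ t, Relation.ReflTransGen (B.Adj (!c)) x t → B.D c t y ∧ B.D c z t := by
    intro t ht
    induction ht with
    | refl => exact ⟨h1, h3⟩
    | tail _ h4 ih =>
      rcases h4 with h4 | h4
      · exact cycle_step hconn ih.1 h2 ih.2 h4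
      · exact (cycle_step (B := B.dual) hconn' ih.2 h2 ih.1 h4).symm
  exact ne_of_D (key y (hconn (!c) x y)).1 rfl

end BicoloredDigraph

/-- `(x, y)` is an arc of a directed pair, which `G'` reverses exactly when `c = true`. -/
def ColoredArc (G G' : Dgraph V) (c : Bool) (x y : V) : Prop :=
  G.Arc x y ∧ ¬ G.Arc y x ∧ (G'.Arc x y ↔ c = false) ∧ (G'.Arc y x ↔ c = true)

/-- `{x, y}` is a neutral pair, of the same kind in `G` and `G'`. -/
def CommonNeutral (G G' : Dgraph V) (x y : V) : Prop :=
  x ≠ y ∧ ∃ ν : Bool, (ν = true ↔ G.Arc x y) ∧ (ν = true ↔ G.Arc y x) ∧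
    (ν = true ↔ G'.Arc x y) ∧ (ν = true ↔ G'.Arc y x)

section

variable {G G' : Dgraph V} {c : Bool} {x y z : V}

theorem ColoredArc.ne (h : ColoredArc G G' c x y) : x ≠ y := by
  rintro rfl
  exact G.irrefl x h.1

theorem ColoredArc.exists_bit (h : ColoredArc G G' c x y ∨ ColoredArc G G' c y x) :
    ∃ d : Bool, (d = true ↔ ColoredArc G G' c x y) ∧ (d = false ↔ ColoredArc G G' c y x) ∧
      (d = true ↔ G.Arc x y) ∧ (d = false ↔ G.Arc y x) ∧
      ((d ^^ c) = true ↔ G'.Arc x y) ∧ ((d ^^ c) = false ↔ G'.Arc y x) := by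
  rcases h with h | h
  · exact ⟨true, by cases c <;> simp_all [ColoredArc]⟩
  · exact ⟨false, by cases c <;> simp_all [ColoredArc]⟩

theorem injective_pair (h : x ≠ y) : Function.Injective ![x, y] := by
  intro i j; fin_cases i <;> fin_cases j <;> simp [h, h.symm]

theorem injective_triple (h1 : x ≠ y) (h2 : x ≠ z) (h3 : y ≠ z) :
    Function.Injective ![x, y, z] := by
  intro i j; fin_cases i <;> fin_cases j <;> simp [h1, h2, h3, h1.symm, h2.symm, h3.symm]

theorem LeHemi.pair (h : LeHemi 5 G G') (hxy : x ≠ y) :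
    ((G'.Arc x y ↔ G.Arc x y) ∧ (G'.Arc y x ↔ G.Arc y x)) ∨
      ((G'.Arc x y ↔ G.Arc y x) ∧ (G'.Arc y x ↔ G.Arc x y)) := by
  classical
  have := hemiSearch_pair (decide (G.Arc x y)) (decide (G.Arc y x)) (decide (G'.Arc x y))
    (decide (G'.Arc y x)) (h.hemiSearch_eq_true (by simp) (by simp) (injective_pair hxy)
      (by simp [Fin.forall_fin_succ, G.irrefl]) (by simp [Fin.forall_fin_succ, G'.irrefl]))
  simpa using this

theorem LeHemi.total (h : LeHemi 5 G G') (hxy : x ≠ y) :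
    CommonNeutral G G' x y ∨ ∃ c, ColoredArc G G' c x y ∨ ColoredArc G G' c y x := by
  classical
  have h1 := h.pair hxy
  by_cases ha : G.Arc x y <;> by_cases hb : G.Arc y x
  · exact Or.inl ⟨hxy, true, by simp_all⟩
  · refine Or.inr ⟨!decide (G'.Arc x y), Or.inl ?_⟩
    by_cases hc : G'.Arc x y <;> simp_all [ColoredArc]
  · refine Or.inr ⟨!decide (G'.Arc y x), Or.inr ?_⟩
    by_cases hc : G'.Arc x y <;> simp_all [ColoredArc]
  · exact Or.inl ⟨hxy, false, by simp_all⟩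

theorem LeHemi.neutral_base (h : LeHemi 5 G G') {c' : Bool} (hN : CommonNeutral G G' y z)
    (hy : ColoredArc G G' c x y ∨ ColoredArc G G' c y x)
    (hz : ColoredArc G G' c' x z ∨ ColoredArc G G' c' z x) : c = c' := by
  have hxy : x ≠ y := hy.elim ColoredArc.ne fun h => h.ne.symm
  have hxz : x ≠ z := hz.elim ColoredArc.ne fun h => h.ne.symm
  obtain ⟨d, -, -, d1, d2, d3, d4⟩ := ColoredArc.exists_bit hy
  obtain ⟨e, -, -, e1, e2, e3, e4⟩ := ColoredArc.exists_bit hz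
  obtain ⟨hyz, ν, n1, n2, n3, n4⟩ := hN
  by_contra hc
  obtain rfl : c' = !c := Bool.eq_not.2 (Ne.symm hc)
  refine Bool.false_ne_true ((hemiSearch_neutral_base ν d e c).symm.trans
    (h.hemiSearch_eq_true (x := ![x, y, z]) (by simp) (by simp) (injective_triple hxy hxz hyz)
      ?_ ?_))
  · simp [Fin.forall_fin_succ, G.irrefl, ← d1, ← d2, ← e1, ← e2, ← n1, ← n2]
  · simp [Fin.forall_fin_succ, G'.irrefl, ← d3, ← d4, ← e3, ← e4, ← n3, ← n4]

theorem LeHemi.cycle (h : LeHemi 5 G G') {c' c'' : Bool} (h1 : ColoredArc G G' c x y)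
    (h2 : ColoredArc G G' c' y z) (h3 : ColoredArc G G' c'' z x) : c = c' := by
  refine (hemiSearch_cycle c c' c'' (h.hemiSearch_eq_true (x := ![x, y, z]) (by simp) (by simp)
    (injective_triple h1.ne h3.ne.symm h2.ne) ?_ ?_)).1
  · simp [Fin.forall_fin_succ, G.irrefl, h1.1, h1.2.1, h2.1, h2.2.1, h3.1, h3.2.1]
  · simp [Fin.forall_fin_succ, G'.irrefl, h1.2.2, h2.2.2, h3.2.2]

theorem LeHemi.transitive (h : LeHemi 5 G G') {c' : Bool} (h1 : ColoredArc G G' c x y)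
    (h2 : ColoredArc G G' c y z) (h3 : ColoredArc G G' c' x z) : c' = c := by
  by_contra hc
  obtain rfl : c' = !c := Bool.eq_not.2 hc
  refine Bool.false_ne_true ((hemiSearch_transitive c).symm.trans
    (h.hemiSearch_eq_true (x := ![x, y, z]) (by simp) (by simp)
      (injective_triple h1.ne h3.ne h2.ne) ?_ ?_))
  · simp [Fin.forall_fin_succ, G.irrefl, h1.1, h1.2.1, h2.1, h2.2.1, h3.1, h3.2.1]
  · simp [Fin.forall_fin_succ, G'.irrefl, h1.2.2, h2.2.2, h3.2.2]

theorem ColoredArc.ne_of_color (hx : ColoredArc G G' c x z ∨ ColoredArc G G' c z x)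
    (hy : ColoredArc G G' (!c) y z ∨ ColoredArc G G' (!c) z y) : x ≠ y := by
  rintro rfl
  cases c <;> simp_all [ColoredArc] <;> grind

theorem LeHemi.neutral_two (h : LeHemi 5 G G') {u v w : V} (hN : CommonNeutral G G' u v)
    (hzu : ColoredArc G G' c z u ∨ ColoredArc G G' c u z)
    (hzv : ColoredArc G G' c z v ∨ ColoredArc G G' c v z)
    (hwu : ColoredArc G G' (!c) w u ∨ ColoredArc G G' (!c) u w)
    (hwv : ColoredArc G G' (!c) w v ∨ ColoredArc G G' (!c) v w) :
    (((ColoredArc G G' c u z ∧ ColoredArc G G' c z v) ∨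
        (ColoredArc G G' c v z ∧ ColoredArc G G' c z u)) ∧
      ((ColoredArc G G' (!c) w u ∧ ColoredArc G G' (!c) w v) ∨
        (ColoredArc G G' (!c) u w ∧ ColoredArc G G' (!c) v w)) ∧
      (ColoredArc G G' (!c) w z ∨ ColoredArc G G' (!c) z w)) ∨
    (((ColoredArc G G' (!c) u w ∧ ColoredArc G G' (!c) w v) ∨
        (ColoredArc G G' (!c) v w ∧ ColoredArc G G' (!c) w u)) ∧
      ((ColoredArc G G' c z u ∧ ColoredArc G G' c z v) ∨
        (ColoredArc G G' c u z ∧ ColoredArc G G' c v z)) ∧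
      (ColoredArc G G' c w z ∨ ColoredArc G G' c z w)) := by
  have hzw : z ≠ w := ColoredArc.ne_of_color hzu hwu
  have huz : u ≠ z := hzu.elim (fun h => h.ne.symm) ColoredArc.ne
  have hvz : v ≠ z := hzv.elim (fun h => h.ne.symm) ColoredArc.ne
  have huw : u ≠ w := hwu.elim (fun h => h.ne.symm) ColoredArc.ne
  have hvw : v ≠ w := hwv.elim (fun h => h.ne.symm) ColoredArc.ne
  obtain ⟨f, hf⟩ := (h.total hzw).resolve_left fun hN' =>
    Bool.not_ne_self c (h.neutral_base hN' hzu.symm hwu.symm).symm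
  obtain ⟨zu, zu0, zu0', zu1, zu2, zu3, zu4⟩ := ColoredArc.exists_bit hzu
  obtain ⟨zv, zv0, zv0', zv1, zv2, zv3, zv4⟩ := ColoredArc.exists_bit hzv
  obtain ⟨wu, wu0, wu0', wu1, wu2, wu3, wu4⟩ := ColoredArc.exists_bit hwu
  obtain ⟨wv, wv0, wv0', wv1, wv2, wv3, wv4⟩ := ColoredArc.exists_bit hwv
  obtain ⟨p, -, -, p1, p2, p3, p4⟩ := ColoredArc.exists_bit hf
  obtain ⟨huv, ν, n1, n2, n3, n4⟩ := hN
  have key := hemiSearch_neutral_two ν zu zv wu wv c p f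
    (h.hemiSearch_eq_true (x := ![u, v, z, w]) (by simp) (by simp) ?_ ?_ ?_)
  · rcases key with ⟨rfl, rfl, rfl⟩ | ⟨rfl, rfl, rfl⟩
    · refine Or.inl ⟨?_, ?_, hf.symm⟩
      · cases zv <;> simp_all
      · cases wu <;> simp_all
    · refine Or.inr ⟨?_, ?_, hf.symm⟩
      · cases wv <;> simp_all
      · cases zu <;> simp_all
  · intro i j
    fin_cases i <;> fin_cases j <;>
      simp [hzw, huz, hvz, huw, hvw, huv, hzw.symm, huz.symm, hvz.symm, huw.symm, hvw.symm,
        huv.symm]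
  · simp [Fin.forall_fin_succ, G.irrefl, ← zu1, ← zu2, ← zv1, ← zv2, ← wu1, ← wu2, ← wv1,
      ← wv2, ← p1, ← p2, ← n1, ← n2]
  · simp [Fin.forall_fin_succ, G'.irrefl, ← zu3, ← zu4, ← zv3, ← zv4, ← wu3, ← wu4, ← wv3,
      ← wv4, ← p3, ← p4, ← n3, ← n4]

theorem ColoredArc.exists_bit_three {t : V}
    (h : (ColoredArc G G' c t x ∧ ColoredArc G G' c t y ∧ ColoredArc G G' c t z) ∨
      (ColoredArc G G' c x t ∧ ColoredArc G G' c y t ∧ ColoredArc G G' c z t)) :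
    ∃ d : Bool, ∀ s, s = x ∨ s = y ∨ s = z → t ≠ s ∧
      (G.Arc t s ↔ d = true) ∧ (G.Arc s t ↔ d = false) ∧
      (G'.Arc t s ↔ (d ^^ c) = true) ∧ (G'.Arc s t ↔ (d ^^ c) = false) := by
  rcases h with ⟨h1, h2, h3⟩ | ⟨h1, h2, h3⟩
  · refine ⟨true, ?_⟩
    rintro s (rfl | rfl | rfl)
    · exact ⟨h1.ne, by cases c <;> simp_all [ColoredArc]⟩
    · exact ⟨h2.ne, by cases c <;> simp_all [ColoredArc]⟩
    · exact ⟨h3.ne, by cases c <;> simp_all [ColoredArc]⟩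
  · refine ⟨false, ?_⟩
    rintro s (rfl | rfl | rfl)
    · exact ⟨h1.ne.symm, by cases c <;> simp_all [ColoredArc]⟩
    · exact ⟨h2.ne.symm, by cases c <;> simp_all [ColoredArc]⟩
    · exact ⟨h3.ne.symm, by cases c <;> simp_all [ColoredArc]⟩

theorem LeHemi.cycle_two (h : LeHemi 5 G G') {w t : V} (h1 : ColoredArc G G' c x y)
    (h2 : ColoredArc G G' c y z) (h3 : ColoredArc G G' c z x)
    (hw : (ColoredArc G G' (!c) w x ∧ ColoredArc G G' (!c) w y ∧ ColoredArc G G' (!c) w z) ∨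
      (ColoredArc G G' (!c) x w ∧ ColoredArc G G' (!c) y w ∧ ColoredArc G G' (!c) z w))
    (ht : (ColoredArc G G' c t x ∧ ColoredArc G G' c t y ∧ ColoredArc G G' c t z) ∨
      (ColoredArc G G' c x t ∧ ColoredArc G G' c y t ∧ ColoredArc G G' c z t)) : False := by
  classical
  have hwt : w ≠ t := (ColoredArc.ne_of_color (ht.imp And.left And.left)
    (hw.imp And.left And.left)).symm
  obtain ⟨a, ha⟩ := ColoredArc.exists_bit_three hw
  obtain ⟨b, hb⟩ := ColoredArc.exists_bit_three ht
  obtain ⟨hwx, wx1, wx2, wx3, wx4⟩ := ha x (by simp)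
  obtain ⟨hwy, wy1, wy2, wy3, wy4⟩ := ha y (by simp)
  obtain ⟨hwz, wz1, wz2, wz3, wz4⟩ := ha z (by simp)
  obtain ⟨htx, tx1, tx2, tx3, tx4⟩ := hb x (by simp)
  obtain ⟨hty, ty1, ty2, ty3, ty4⟩ := hb y (by simp)
  obtain ⟨htz, tz1, tz2, tz3, tz4⟩ := hb z (by simp)
  obtain ⟨f, f1, f2⟩ : ∃ f : Bool,
      (G'.Arc w t ↔ (if f then decide (G.Arc t w) else decide (G.Arc w t)) = true) ∧
      (G'.Arc t w ↔ (if f then decide (G.Arc w t) else decide (G.Arc t w)) = true) := by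
    rcases h.pair hwt with h | h
    · exact ⟨false, by simpa using h⟩
    · exact ⟨true, by simpa using h⟩
  refine Bool.false_ne_true
    ((hemiSearch_cycle_two a b c (decide (G.Arc w t)) (decide (G.Arc t w)) f).symm.trans
      (h.hemiSearch_eq_true (x := ![x, y, z, w, t]) (by simp) (by simp) ?_ ?_ ?_))
  · have h1 := h1.ne
    have h2 := h2.ne
    have h3 := h3.ne
    intro i j
    fin_cases i <;> fin_cases j <;>
      simp [hwt, hwx, hwy, hwz, htx, hty, htz, h1, h2, h3, hwt.symm, hwx.symm, hwy.symm, hwz.symm,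
        htx.symm, hty.symm, htz.symm, h1.symm, h2.symm, h3.symm]
  · simp [Fin.forall_fin_succ, G.irrefl, h1.1, h1.2.1, h2.1, h2.2.1, h3.1, h3.2.1, wx1, wx2, wy1,
      wy2, wz1, wz2, tx1, tx2, ty1, ty2, tz1, tz2]
  · simp [Fin.forall_fin_succ, G'.irrefl, h1.2.2, h2.2.2, h3.2.2, wx3, wx4, wy3,
      wy4, wz3, wz4, tx3, tx4, ty3, ty4, tz3, tz4, f1, f2]

/-- Two `(≤ 5)`-hemimorphic digraphs form a bicolored digraph. -/
def LeHemi.bicolored (h : LeHemi 5 G G') : BicoloredDigraph V where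
  D := ColoredArc G G'
  N := CommonNeutral G G'
  total := h.total
  color_eq := by
    intro c c' x y h1 h2
    cases c <;> cases c' <;> simp_all [ColoredArc]
  asymm h1 h2 := h1.2.1 h2.1
  not_neutral := by
    rintro c x y ⟨h1, h2, -⟩ ⟨-, ν, n1, n2, -⟩
    exact h2 (n2.1 (n1.2 h1))
  neutral_symm := fun ⟨h, ν, n1, n2, n3, n4⟩ => ⟨h.symm, ν, n2, n1, n4, n3⟩
  neutral_irrefl h := h.1 rfl
  neutral_base := h.neutral_base
  cycle := h.cycle
  transitive := h.transitive
  neutral_two := h.neutral_two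
  cycle_two := h.cycle_two

theorem reflTransGen_diffStep_of_existsUnique (h : ∃! C : Set V, DiffClass G G' C) (x y : V) :
    Relation.ReflTransGen (DiffStep G G') x y := by
  have h1 : {t | DiffRel G G' x t} = {t | DiffRel G G' y t} := h.unique ⟨x, rfl⟩ ⟨y, rfl⟩
  have h2 : DiffRel G G' x y := h1.symm.subset (Or.inl rfl)
  rcases h2 with rfl | h2
  · exact Relation.ReflTransGen.refl
  · exact h2.to_reflTransGen

theorem LeHemi.adj_true (h : LeHemi 5 G G') (hxy : DiffStep G G' x y) :
    h.bicolored.Adj true x y := by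
  have hne : x ≠ y := by
    rintro rfl
    exact G.irrefl x (hxy.2 (G'.irrefl x))
  have h1 := h.pair hne
  unfold DiffStep at hxy
  change ColoredArc G G' true x y ∨ ColoredArc G G' true y x
  unfold ColoredArc
  grind

theorem LeHemi.adj_false (h : LeHemi 5 G G') (hxy : DiffStep G.dual G' x y) :
    h.bicolored.Adj false x y := by
  have hne : x ≠ y := by
    rintro rfl
    exact G.irrefl x (hxy.2 (G'.irrefl x))
  have h1 := h.pair hne
  replace hxy : G.Arc y x ↔ ¬ G'.Arc x y := hxy
  change ColoredArc G G' false x y ∨ ColoredArc G G' false y x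
  unfold ColoredArc
  grind

end

end Dgraph

/-- If G and G' are (≤5)-hemimorphic and both difference relations 𝔇_{G,G'} and
𝔇_{G*,G'} have exactly one equivalence class, then G is a chain. -/
theorem chain_of_one_diff_class {V : Type u} (G G' : Dgraph V)
    (hhemi : Dgraph.LeHemi 5 G G')
    (h₁ : ∃! C : Set V, Dgraph.DiffClass G G' C)
    (h₂ : ∃! C : Set V, Dgraph.DiffClass G.dual G' C) :
    G.IsChainD := by
  have hconn : ∀ c x y, Relation.ReflTransGen (hhemi.bicolored.Adj c) x y := by
    rintro (_ | _) x y
    · exact (reflTransGen_diffStep_of_existsUnique h₂ x y).lift id fun _ _ => hhemi.adj_false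
    · exact (reflTransGen_diffStep_of_existsUnique h₁ x y).lift id fun _ _ => hhemi.adj_true
  have hdir : ∀ {x y}, x ≠ y → ∃ c, ColoredArc G G' c x y ∨ ColoredArc G G' c y x := fun h =>
    (hhemi.total h).resolve_left (BicoloredDigraph.not_neutral_of_connected hconn)
  have harc : ∀ {x y}, G.Arc x y → ∃ c, ColoredArc G G' c x y := by
    intro x y h
    obtain ⟨c, hc | hc⟩ := hdir (x := x) (y := y) (by rintro rfl; exact G.irrefl x h)
    · exact ⟨c, hc⟩
    · exact absurd h hc.2.1
  refine ⟨fun x y hxy => ?_, fun x y z hxy hyz => ?_⟩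
  · obtain ⟨c, hc | hc⟩ := hdir hxy
    · exact Or.inl ⟨hc.1, hc.2.1⟩
    · exact Or.inr ⟨hc.1, hc.2.1⟩
  · obtain ⟨c₁, h1⟩ := harc hxy
    obtain ⟨c₂, h2⟩ := harc hyz
    obtain ⟨c₃, h3 | h3⟩ := hdir (x := x) (y := z) (by rintro rfl; exact h1.2.1 hyz)
    · exact h3.1
    · obtain rfl := hhemi.cycle h1 h2 h3
      obtain rfl := hhemi.cycle h2 h3 h1
      exact (BicoloredDigraph.not_cycle (B := hhemi.bicolored) hconn h1 h2 h3).elim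
end
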